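/- arXiv:0912.0428 — 3 statements merged into one kernel-verified Lean document; each statement's English description precedes it below -/
import Mathlib

section
/- Let F ∈ Diff(ℂⁿ;0) be one-resonant and non-degenerate with respect to {λ₁,…,λ_m} with index of resonance α. Then there exist k ∈ ℕ (the order of F) and numbers μ, a₁,…,a_m ∈ ℂ such that F is formally conjugated to the map F̂(z) = (F̂₁(z),…,F̂ₙ(z)) where F̂_j(z) = λ_j z_j + a_j z^{kα} z_j + μ α_j (conj λ_j)^{-1} z^{2kα} z_j for j = 1,…,m, and the components F̂_j(z) for j = m+1,…,n contain only resonant monomials (i.e., monomials z^l with λ_j = λ^l). -/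
open Filter

namespace OneResonant

open Asymptotics Topology

section Vanishing

open MvPolynomial

variable {E : Type*} [NormedAddCommGroup E]

/-- `f` vanishes to order at least `d` at the origin. -/
def Vanishes (d : ℕ) (f : E → ℂ) : Prop :=
  f =O[𝓝 0] fun z : E => ‖z‖ ^ d

lemma Vanishes.mono {d e : ℕ} {f : E → ℂ} (hf : Vanishes d f) (h : e ≤ d) : Vanishes e f := by
  refine hf.trans (IsBigO.of_bound 1 ?_)
  filter_upwards [Metric.ball_mem_nhds (0 : E) one_pos] with z hz
  have hz1 : ‖z‖ ≤ 1 := by simpa using (mem_ball_zero_iff.1 hz).le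
  simpa using pow_le_pow_of_le_one (norm_nonneg z) hz1 h

lemma Vanishes.add {d : ℕ} {f g : E → ℂ} (hf : Vanishes d f) (hg : Vanishes d g) :
    Vanishes d (fun z => f z + g z) :=
  IsBigO.add hf hg

lemma Vanishes.sub {d : ℕ} {f g : E → ℂ} (hf : Vanishes d f) (hg : Vanishes d g) :
    Vanishes d (fun z => f z - g z) :=
  IsBigO.sub hf hg

lemma Vanishes.mul {d e : ℕ} {f g : E → ℂ} (hf : Vanishes d f) (hg : Vanishes e g) :
    Vanishes (d + e) (fun z => f z * g z) := by
  have := IsBigO.mul hf hg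
  simpa only [Vanishes, pow_add] using this

lemma Vanishes.const_mul {d : ℕ} {f : E → ℂ} (c : ℂ) (hf : Vanishes d f) :
    Vanishes d (fun z => c * f z) :=
  IsBigO.const_mul_left hf c

lemma Vanishes.zero (d : ℕ) : Vanishes d (fun _ : E => (0 : ℂ)) :=
  isBigO_zero _ _

lemma Vanishes.sum {ι : Type*} {d : ℕ} {s : Finset ι} {f : ι → E → ℂ}
    (hf : ∀ i ∈ s, Vanishes d (f i)) : Vanishes d (fun z => ∑ i ∈ s, f i z) :=
  IsBigO.fun_sum hf

lemma Vanishes.congr {d : ℕ} {f g : E → ℂ} (hf : Vanishes d f) (h : ∀ z, f z = g z) :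
    Vanishes d g :=
  (funext h : f = g) ▸ hf

lemma vanishes_zero_of_continuousAt {f : E → ℂ} (hf : ContinuousAt f 0) : Vanishes 0 f := by
  simpa [Vanishes] using hf.tendsto.isBigO_one ℝ

lemma Vanishes.comp {E' : Type*} [NormedAddCommGroup E'] {d : ℕ} {f : E → ℂ}
    (hf : Vanishes d f) {φ : E' → E} (hφ : Filter.Tendsto φ (𝓝 0) (𝓝 0))
    (hφO : φ =O[𝓝 0] fun z : E' => ‖z‖) : Vanishes d (fun z => f (φ z)) :=
  (hf.comp_tendsto hφ).trans (hφO.norm_left.pow d)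

variable {ι : Type*}

lemma vanishes_pow {e : ℕ} {f : E → ℂ} (hf : Vanishes 1 f) : Vanishes e (fun z => f z ^ e) := by
  simpa [Vanishes] using IsBigO.pow hf e

lemma vanishes_prod_pow (s : Finset ι) (l : ι → ℕ) {f : E → ι → ℂ}
    (hf : ∀ i ∈ s, l i ≠ 0 → Vanishes 1 (fun z => f z i)) :
    Vanishes (∑ i ∈ s, l i) (fun z => ∏ i ∈ s, f z i ^ l i) := by
  classical
  induction s using Finset.induction_on with
  | empty => simpa using vanishes_zero_of_continuousAt (E := E) continuousAt_const
  | insert i s hi ih =>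
    simp only [Finset.sum_insert hi, Finset.prod_insert hi]
    refine Vanishes.mul ?_ (ih fun j hj => hf j (Finset.mem_insert_of_mem hj))
    by_cases h0 : l i = 0
    · simpa [h0] using vanishes_zero_of_continuousAt (E := E) continuousAt_const
    · exact vanishes_pow (hf i (Finset.mem_insert_self _ _) h0)

lemma vanishes_pow_sub_pow {e s : ℕ} {f g : E → ℂ} (hf : Vanishes 1 f) (hg : Vanishes 1 g)
    (hfg : Vanishes (s + 1) (fun z => f z - g z)) :
    Vanishes (e + s) (fun z => f z ^ e - g z ^ e) := by
  induction e with
  | zero => simpa using Vanishes.zero (E := E) s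
  | succ e ih =>
    have h1 := (ih.mul hf).add ((vanishes_pow (e := e) hg).mul hfg |>.mono
      (show e + s + 1 ≤ e + (s + 1) by omega))
    exact (h1.mono (by omega)).congr fun z => by ring

lemma vanishes_prod_pow_sub_prod_pow (s : Finset ι) (l : ι → ℕ) {r : ℕ} {f g : E → ι → ℂ}
    (hf : ∀ i ∈ s, l i ≠ 0 → Vanishes 1 (fun z => f z i))
    (hg : ∀ i ∈ s, l i ≠ 0 → Vanishes 1 (fun z => g z i))
    (hfg : ∀ i ∈ s, l i ≠ 0 → Vanishes (r + 1) (fun z => f z i - g z i)) :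
    Vanishes (∑ i ∈ s, l i + r) (fun z => ∏ i ∈ s, f z i ^ l i - ∏ i ∈ s, g z i ^ l i) := by
  classical
  induction s using Finset.induction_on with
  | empty => simpa using Vanishes.zero (E := E) r
  | insert i s hi ih =>
    have hf' := fun j hj => hf j (Finset.mem_insert_of_mem (b := i) hj)
    have hg' := fun j hj => hg j (Finset.mem_insert_of_mem (b := i) hj)
    have ih' := ih hf' hg' fun j hj => hfg j (Finset.mem_insert_of_mem hj)
    by_cases h0 : l i = 0
    · simpa [Finset.sum_insert hi, Finset.prod_insert hi, h0] using ih'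
    have hi' := Finset.mem_insert_self i s
    have h1 := (vanishes_pow_sub_pow (e := l i) (hf i hi' h0) (hg i hi' h0) (hfg i hi' h0)).mul
      (vanishes_prod_pow s l hf')
    have h2 := (vanishes_pow (e := l i) (hg i hi' h0)).mul ih'
    rw [Finset.sum_insert hi]
    refine ((h1.mono (e := l i + ∑ i ∈ s, l i + r) (by omega)).add
      (h2.mono (by omega))).congr fun z => ?_
    rw [Finset.prod_insert hi, Finset.prod_insert hi]
    ring

variable [Fintype ι]

lemma vanishes_eval {Q : MvPolynomial ι ℂ} {d : ℕ}
    (hQ : ∀ l ∈ Q.support, d ≤ ∑ i, l i) {f : E → ι → ℂ}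
    (hf : ∀ i, Vanishes 1 (fun z => f z i)) :
    Vanishes d (fun z => eval (f z) Q) := by
  simp only [eval_eq']
  refine Vanishes.sum fun l hl => Vanishes.const_mul _ ?_
  exact (vanishes_prod_pow Finset.univ l fun i _ _ => hf i).mono (hQ l hl)

lemma vanishes_eval_sub_eval {Q : MvPolynomial ι ℂ} {d r : ℕ}
    (hQ : ∀ l ∈ Q.support, d ≤ ∑ i, l i) {f g : E → ι → ℂ}
    (hf : ∀ i, Vanishes 1 (fun z => f z i)) (hg : ∀ i, Vanishes 1 (fun z => g z i))
    (hfg : ∀ i, Vanishes (r + 1) (fun z => f z i - g z i)) :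
    Vanishes (d + r) (fun z => eval (f z) Q - eval (g z) Q) := by
  simp only [eval_eq', ← Finset.sum_sub_distrib, ← mul_sub]
  refine Vanishes.sum fun l hl => Vanishes.const_mul _ ?_
  exact (vanishes_prod_pow_sub_prod_pow Finset.univ l (fun i _ _ => hf i) (fun i _ _ => hg i)
    fun i _ _ => hfg i).mono (Nat.add_le_add_right (hQ l hl) r)

end Vanishing

section Taylor

open MvPolynomial

variable {ι : Type*} [Fintype ι]

lemma exists_homogeneous_of_multilinear {d : ℕ} (p : (ι → ℂ) [×d]→L[ℂ] ℂ) :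
    ∃ Q : MvPolynomial ι ℂ, Q.IsHomogeneous d ∧ ∀ z, eval z Q = p fun _ => z := by
  classical
  refine ⟨∑ r : Fin d → ι, C (p fun i => Pi.single (r i) 1) * ∏ i, X (r i), ?_, fun z => ?_⟩
  · refine IsHomogeneous.sum _ _ _ fun r _ => ?_
    have h := (IsHomogeneous.prod Finset.univ (fun i => X (R := ℂ) (r i)) (fun _ => 1)
      fun i _ => isHomogeneous_X ℂ (r i))
    simpa using (isHomogeneous_C ι (p fun i => Pi.single (r i) 1)).mul h
  · have hz : (fun _ : Fin d => z) = fun _ => ∑ j, z j • (Pi.single j 1 : ι → ℂ) := by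
      funext _
      exact pi_eq_sum_univ' z
    rw [hz]
    have := p.toMultilinearMap.map_sum (fun (_ : Fin d) (j : ι) => z j • (Pi.single j 1 : ι → ℂ))
    simp only [ContinuousMultilinearMap.coe_coe] at this
    rw [this]
    simp [ContinuousMultilinearMap.map_smul_univ, mul_comm]

lemma exists_homogeneous_leading_part {d : ℕ} {f : (ι → ℂ) → ℂ} (hf : AnalyticAt ℂ f 0)
    (hd : Vanishes d f) :
    ∃ Q : MvPolynomial ι ℂ, Q.IsHomogeneous d ∧ Vanishes (d + 1) (fun z => f z - eval z Q) := by
  obtain ⟨p, hp⟩ := hf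
  have hT : ∀ e, Vanishes e (fun z => f z - ∑ i ∈ Finset.range e, p i fun _ => z) := by
    intro e
    simpa [Vanishes, FormalMultilinearSeries.partialSum] using hp.isBigO_sub_partialSum_pow e
  have h0 : ∀ e < d, ∀ z, (p e fun _ => z) = 0 := by
    intro e
    induction e using Nat.strong_induction_on with
    | _ e ih =>
      intro he
      refine fun z => IsBigO.continuousMultilinearMap_apply_eq_zero ?_ z
      refine ((hd.mono (e := e + 1) he).sub (hT (e + 1))).congr fun z => ?_
      rw [Finset.sum_range_succ, Finset.sum_eq_zero fun i hi => ih i (Finset.mem_range.1 hi)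
        ((Finset.mem_range.1 hi).trans he) z]
      ring
  obtain ⟨Q, hQ, hQe⟩ := exists_homogeneous_of_multilinear (p d)
  refine ⟨Q, hQ, (hT (d + 1)).congr fun z => ?_⟩
  rw [Finset.sum_range_succ, Finset.sum_eq_zero fun i hi => h0 i (Finset.mem_range.1 hi) z, hQe]
  ring

end Taylor

section Homological

open MvPolynomial

variable {ι : Type*} [Fintype ι]

/-- Every monomial of the `j`-th component `Q` is resonant. -/
def IsResonant (lam : ι → ℂ) (j : ι) (Q : MvPolynomial ι ℂ) : Prop :=
  ∀ l ∈ Q.support, lam j = ∏ i, lam i ^ l i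

lemma exists_homological_solution (lam : ι → ℂ) (j : ι) {d : ℕ} {Q : MvPolynomial ι ℂ}
    (hQ : Q.IsHomogeneous d) :
    ∃ h g : MvPolynomial ι ℂ, h.IsHomogeneous d ∧ g.IsHomogeneous d ∧ IsResonant lam j g ∧
      ∀ z, eval z Q + eval (fun i => lam i * z i) h - lam j * eval z h = eval z g := by
  classical
  let ev : (ι →₀ ℕ) → ℂ := fun l => ∏ i, lam i ^ l i
  refine ⟨∑ l ∈ Q.support, monomial l (if lam j = ev l then 0 else coeff l Q / (lam j - ev l)),
    ∑ l ∈ Q.support with lam j = ev l, monomial l (coeff l Q), ?_, ?_, ?_, fun z => ?_⟩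
  · exact IsHomogeneous.sum _ _ _ fun l hl => isHomogeneous_monomial _
      (by rw [Finsupp.degree_eq_weight_one]; exact hQ (mem_support_iff.1 hl))
  · exact IsHomogeneous.sum _ _ _ fun l hl => isHomogeneous_monomial _
      (by rw [Finsupp.degree_eq_weight_one]
          exact hQ (mem_support_iff.1 (Finset.mem_filter.1 hl).1))
  · intro l hl
    obtain ⟨l', hl', hl⟩ := Finset.mem_biUnion.1 (support_sum hl)
    rw [Finset.mem_singleton.1 (support_monomial_subset hl)]
    exact (Finset.mem_filter.1 hl').2
  · rw [Finset.sum_filter]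
    simp only [map_sum, apply_ite (eval z), map_zero, eval_monomial,
      Finsupp.prod_pow]
    simp only [mul_pow, Finset.prod_mul_distrib]
    rw [eval_eq', Finset.mul_sum, ← Finset.sum_add_distrib, ← Finset.sum_sub_distrib]
    refine Finset.sum_congr rfl fun l _ => ?_
    by_cases hl : lam j = ev l
    · simp [hl]
    · have hne : lam j - ev l ≠ 0 := sub_ne_zero.2 hl
      rw [if_neg hl, if_neg hl]
      change _ + _ * (ev l * _) - _ = _
      field_simp
      ring

lemma sum_eq_of_mem_support {d : ℕ} {Q : MvPolynomial ι ℂ} (hQ : Q.IsHomogeneous d)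
    {l : ι →₀ ℕ} (hl : l ∈ Q.support) : ∑ i, l i = d := by
  rw [← hQ (mem_support_iff.1 hl), ← Finsupp.degree_eq_sum, Finsupp.degree_eq_weight_one]
  rfl

end Homological

section Conjugacy

open MvPolynomial

variable {ι : Type*} [Fintype ι]

lemma vanishes_coord (j : ι) : Vanishes 1 (fun z : ι → ℂ => z j) := by
  refine IsBigO.of_bound 1 (Filter.Eventually.of_forall fun z => ?_)
  simpa using norm_le_pi_norm z j

lemma Vanishes.one_of_sub {d : ℕ} {E : Type*} [NormedAddCommGroup E] {f g : E → ℂ}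
    (hfg : Vanishes (d + 1) (fun z => f z - g z)) (hg : Vanishes 1 g) : Vanishes 1 f :=
  ((hfg.mono (Nat.le_add_left 1 d)).add hg).congr fun _ => sub_add_cancel _ _

lemma tendsto_zero_of_vanishes {φ : (ι → ℂ) → ι → ℂ}
    (h : ∀ j, Vanishes 1 (fun z => φ z j)) : Filter.Tendsto φ (𝓝 0) (𝓝 0) := by
  have hO : φ =O[𝓝 0] fun z : ι → ℂ => ‖z‖ ^ 1 := isBigO_pi.2 h
  refine hO.trans_tendsto ?_
  have : Continuous fun z : ι → ℂ => ‖z‖ ^ 1 := by fun_prop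
  simpa using this.tendsto 0

lemma Vanishes.comp_pi {d : ℕ} {f : (ι → ℂ) → ℂ} (hf : Vanishes d f) {φ : (ι → ℂ) → ι → ℂ}
    (h : ∀ j, Vanishes 1 (fun z => φ z j)) : Vanishes d (fun z => f (φ z)) := by
  refine hf.comp (tendsto_zero_of_vanishes h) ?_
  have hO : φ =O[𝓝 0] fun z : ι → ℂ => ‖z‖ ^ 1 := isBigO_pi.2 h
  simpa using hO

lemma apply_zero_of_vanishes {φ : (ι → ℂ) → ι → ℂ}
    (h : ∀ j, Vanishes 1 (fun z => φ z j)) : φ 0 = 0 := by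
  have hO : φ =O[𝓝 0] fun z : ι → ℂ => ‖z‖ ^ 1 := isBigO_pi.2 h
  have := hO.eq_zero_imp.self_of_nhds
  simpa using this

lemma analyticAt_eval (Q : MvPolynomial ι ℂ) {φ : (ι → ℂ) → ι → ℂ} {z : ι → ℂ}
    (hφ : AnalyticAt ℂ φ z) : AnalyticAt ℂ (fun z => eval (φ z) Q) z := by
  have := AnalyticAt.aeval_mvPolynomial (fun i => analyticAt_pi_iff.1 hφ i) Q
  simpa [aeval_eq_eval] using this

/-- `Ψ` is analytic and tangent to the identity, and it conjugates the components of `F` with index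
in `J` to `y ↦ lam j * y j + Q j`, up to order `d`. -/
structure IsConjugacy (lam : ι → ℂ) (F : (ι → ℂ) → ι → ℂ) (J : Set ι) (d : ℕ)
    (Ψ : (ι → ℂ) → ι → ℂ) (Q : ι → MvPolynomial ι ℂ) : Prop where
  analyticAt : AnalyticAt ℂ Ψ 0
  tangent : ∀ j, Vanishes 2 (fun z => Ψ z j - z j)
  error : ∀ j ∈ J, Vanishes d (fun z => Ψ (F z) j - (lam j * Ψ z j + eval (Ψ z) (Q j)))

variable {lam : ι → ℂ} {F : (ι → ℂ) → ι → ℂ} {J : Set ι} {d : ℕ}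
  {Ψ : (ι → ℂ) → ι → ℂ} {Q : ι → MvPolynomial ι ℂ}

lemma IsConjugacy.mono (h : IsConjugacy lam F J d Ψ Q) {e : ℕ} (he : e ≤ d) :
    IsConjugacy lam F J e Ψ Q :=
  ⟨h.analyticAt, h.tangent, fun j hj => (h.error j hj).mono he⟩

lemma IsConjugacy.vanishes_one (h : IsConjugacy lam F J d Ψ Q) (j : ι) :
    Vanishes 1 (fun z => Ψ z j) :=
  (h.tangent j).one_of_sub (vanishes_coord j)

lemma vanishes_one_of_linear_part (hFlin : ∀ j, Vanishes 2 (fun z => F z j - lam j * z j)) (j : ι) :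
    Vanishes 1 (fun z => F z j) :=
  (hFlin j).one_of_sub ((vanishes_coord j).const_mul _)

lemma IsConjugacy.error_analyticAt (h : IsConjugacy lam F J d Ψ Q) (hF : AnalyticAt ℂ F 0)
    (hF0 : F 0 = 0) (j : ι) :
    AnalyticAt ℂ (fun z => Ψ (F z) j - (lam j * Ψ z j + eval (Ψ z) (Q j))) 0 := by
  have h1 : AnalyticAt ℂ (fun z => Ψ (F z)) 0 := by
    refine AnalyticAt.fun_comp ?_ hF
    rw [hF0]
    exact h.analyticAt
  exact (analyticAt_pi_iff.1 h1 j).fun_sub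
    ((analyticAt_const.fun_mul (analyticAt_pi_iff.1 h.analyticAt j)).fun_add
      (analyticAt_eval _ h.analyticAt))

/-- One step of the Poincaré–Dulac procedure: a homogeneous change of the components in `J`
makes the leading part of the conjugacy error resonant. -/
lemma IsConjugacy.exists_resonant_error (h : IsConjugacy lam F J d Ψ Q) (hF : AnalyticAt ℂ F 0)
    (hFlin : ∀ j, Vanishes 2 (fun z => F z j - lam j * z j)) (hd : 2 ≤ d)
    (hQ : ∀ j ∈ J, ∀ l ∈ (Q j).support, 2 ≤ ∑ i, l i) :
    ∃ (Ψ' : (ι → ℂ) → ι → ℂ) (g : ι → MvPolynomial ι ℂ),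
      IsConjugacy lam F J d Ψ' Q ∧ (∀ j ∉ J, ∀ z, Ψ' z j = Ψ z j) ∧
      ∀ j ∈ J, (g j).IsHomogeneous d ∧ IsResonant lam j (g j) ∧
        Vanishes (d + 1) (fun z =>
          Ψ' (F z) j - (lam j * Ψ' z j + eval (Ψ' z) (Q j)) - eval z (g j)) := by
  classical
  have hF1 := vanishes_one_of_linear_part hFlin
  have hF0 := apply_zero_of_vanishes hF1
  have key : ∀ j, ∃ p g : MvPolynomial ι ℂ, p.IsHomogeneous d ∧ (j ∉ J → p = 0) ∧
      (j ∈ J → g.IsHomogeneous d ∧ IsResonant lam j g ∧ Vanishes (d + 1) (fun z =>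
        Ψ (F z) j - (lam j * Ψ z j + eval (Ψ z) (Q j)) +
          eval (fun i => lam i * z i) p - lam j * eval z p - eval z g)) := by
    intro j
    by_cases hj : j ∈ J
    · obtain ⟨R, hR, hRe⟩ := exists_homogeneous_leading_part (h.error_analyticAt hF hF0 j)
        (h.error j hj)
      obtain ⟨p, g, hp, hg, hgr, hpg⟩ := exists_homological_solution lam j hR
      refine ⟨p, g, hp, fun h => absurd hj h, fun _ => ⟨hg, hgr, hRe.congr fun z => ?_⟩⟩
      rw [← hpg]
      ring
    · exact ⟨0, 0, isHomogeneous_zero _ _ _, fun _ => rfl, fun h => absurd h hj⟩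
  choose p g hp hpJ hg using key
  have hpd : ∀ j, Vanishes d (fun z => eval z (p j)) := fun j =>
    vanishes_eval (fun l hl => (sum_eq_of_mem_support (hp j) hl).ge) vanishes_coord
  have hpF : ∀ j, Vanishes (d + 1) (fun z =>
      eval (F z) (p j) - eval (fun i => lam i * z i) (p j)) := fun j =>
    vanishes_eval_sub_eval (fun l hl => (sum_eq_of_mem_support (hp j) hl).ge) hF1
      (fun i => (vanishes_coord i).const_mul _) hFlin
  have htan : ∀ j, Vanishes 2 (fun z => Ψ z j + eval z (p j) - z j) := fun j =>
    ((h.tangent j).add ((hpd j).mono hd)).congr fun z => by ring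
  have hΨ1 : ∀ j, Vanishes 1 (fun z => Ψ z j + eval z (p j)) := fun j =>
    (htan j).one_of_sub (vanishes_coord j)
  have herr : ∀ j ∈ J, Vanishes (d + 1) (fun z => Ψ (F z) j + eval (F z) (p j) -
      (lam j * (Ψ z j + eval z (p j)) + eval (fun i => Ψ z i + eval z (p i)) (Q j)) -
      eval z (g j)) := by
    intro j hj
    obtain ⟨e, rfl⟩ : ∃ e, d = e + 1 := ⟨d - 1, by omega⟩
    have h1 : Vanishes (2 + e) (fun z =>
        eval (fun i => Ψ z i + eval z (p i)) (Q j) - eval (Ψ z) (Q j)) :=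
      vanishes_eval_sub_eval (hQ j hj) hΨ1 h.vanishes_one fun i =>
        (hpd i).congr fun z => by ring
    refine (((hg j hj).2.2.add (hpF j)).sub (h1.mono (by omega))).congr fun z => ?_
    ring
  refine ⟨fun z j => Ψ z j + eval z (p j), g, ⟨?_, htan, fun j hj => ?_⟩,
    fun j hj z => by simp [hpJ j hj], fun j hj => ⟨(hg j hj).1, (hg j hj).2.1, herr j hj⟩⟩
  · exact analyticAt_pi_iff.2 fun j =>
      (analyticAt_pi_iff.1 h.analyticAt j).fun_add (analyticAt_eval _ analyticAt_id)
  · refine (((herr j hj).mono (Nat.le_succ d)).add (vanishes_eval (d := d)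
      (fun l hl => (sum_eq_of_mem_support (hg j hj).1 hl).ge) vanishes_coord)).congr fun z => ?_
    ring

/-- Poincaré–Dulac normalization of the components outside `J`, the components in `J` being
already normalized by polynomials depending on the coordinates in `J` only. -/
lemma IsConjugacy.exists_extend (h : IsConjugacy lam F J d Ψ Q) (hF : AnalyticAt ℂ F 0)
    (hFlin : ∀ j, Vanishes 2 (fun z => F z j - lam j * z j))
    (hQJ : ∀ j ∈ J, ∀ y y' : ι → ℂ, (∀ i ∈ J, y i = y' i) → eval y (Q j) = eval y' (Q j)) :
    ∃ (Ψ' : (ι → ℂ) → ι → ℂ) (Q' : ι → MvPolynomial ι ℂ), IsConjugacy lam F Set.univ d Ψ' Q' ∧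
      (∀ j ∈ J, Q' j = Q j) ∧
      ∀ j ∉ J, IsResonant lam j (Q' j) ∧ ∀ l ∈ (Q' j).support, 2 ≤ ∑ i, l i := by
  classical
  have hF1 := vanishes_one_of_linear_part hFlin
  have key : ∀ e, 2 ≤ e → ∃ (Ψ' : (ι → ℂ) → ι → ℂ) (Q' : ι → MvPolynomial ι ℂ),
      IsConjugacy lam F Jᶜ e Ψ' Q' ∧ (∀ j ∈ J, ∀ z, Ψ' z j = Ψ z j) ∧
      ∀ j, IsResonant lam j (Q' j) ∧ ∀ l ∈ (Q' j).support, 2 ≤ ∑ i, l i := by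
    intro e he
    induction e, he using Nat.le_induction with
    | base =>
      refine ⟨Ψ, 0, ⟨h.analyticAt, h.tangent, fun j _ => ?_⟩, fun _ _ _ => rfl,
        fun j => ⟨fun l hl => by simp at hl, fun l hl => by simp at hl⟩⟩
      refine ((((h.tangent j).comp_pi hF1).add (hFlin j)).sub
        ((h.tangent j).const_mul (lam j))).congr fun z => ?_
      simp only [Pi.zero_apply, map_zero]
      ring
    | succ e he ih =>
      obtain ⟨Ψ₁, Q₁, h₁, hΨ₁, hQ₁⟩ := ih
      obtain ⟨Ψ₂, g, h₂, hΨ₂, hg⟩ := h₁.exists_resonant_error hF hFlin he fun j _ => (hQ₁ j).2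
      refine ⟨Ψ₂, fun j => if j ∈ J then 0 else Q₁ j + g j,
        ⟨h₂.analyticAt, h₂.tangent, fun j hj => ?_⟩,
        fun j hj z => (hΨ₂ j (fun h => h hj) z).trans (hΨ₁ j hj z), fun j => ?_⟩
      · obtain ⟨hg1, hg2, hg3⟩ := hg j hj
        have h4 : Vanishes (e + 1) (fun z => eval (Ψ₂ z) (g j) - eval z (g j)) :=
          vanishes_eval_sub_eval (fun l hl => (sum_eq_of_mem_support hg1 hl).ge)
            h₂.vanishes_one vanishes_coord h₂.tangent
        refine (hg3.sub h4).congr fun z => ?_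
        rw [if_neg hj, map_add]
        ring
      · by_cases hj : j ∈ J
        · simp [hj, IsResonant]
        · obtain ⟨hg1, hg2, -⟩ := hg j hj
          simp only [if_neg hj]
          have hsup : ∀ l ∈ (Q₁ j + g j).support, l ∈ (Q₁ j).support ∨ l ∈ (g j).support :=
            fun l hl => Finset.mem_union.1 (support_add hl)
          exact ⟨fun l hl => (hsup l hl).elim ((hQ₁ j).1 l) (hg2 l), fun l hl =>
            (hsup l hl).elim ((hQ₁ j).2 l)
              fun hl => he.trans (sum_eq_of_mem_support hg1 hl).ge⟩
  obtain ⟨Ψ', Q', h', hΨ', hQ'⟩ := key (max d 2) (le_max_right _ _)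
  refine ⟨Ψ', fun j => if j ∈ J then Q j else Q' j,
    ⟨h'.analyticAt, h'.tangent, fun j _ => ?_⟩, fun j hj => if_pos hj,
    fun j hj => by simpa only [if_neg hj] using hQ' j⟩
  by_cases hj : j ∈ J
  · refine (h.error j hj).congr fun z => ?_
    rw [if_pos hj, hΨ' j hj, hΨ' j hj, hQJ j hj (Ψ' z) (Ψ z) fun i hi => hΨ' i hi z]
  · simpa only [if_neg hj] using (h'.error j hj).mono (le_max_left _ _)

/-- A germ tangent to the identity is a change of coordinates; transporting `F` by it gives a
germ whose components agree with those of the normalized map. -/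
lemma IsConjugacy.exists_conjugate (h : IsConjugacy lam F J d Ψ Q) (hF : AnalyticAt ℂ F 0)
    (hFlin : ∀ j, Vanishes 2 (fun z => F z j - lam j * z j)) :
    ∃ G : (ι → ℂ) → ι → ℂ, AnalyticAt ℂ G 0 ∧ (∀ᶠ z in 𝓝 0, Ψ (F z) = G (Ψ z)) ∧
      ∀ j ∈ J, Vanishes d (fun z => G z j - (lam j * z j + eval z (Q j))) := by
  have hF0 := apply_zero_of_vanishes (vanishes_one_of_linear_part hFlin)
  have hΨ0 : Ψ 0 = 0 := apply_zero_of_vanishes h.vanishes_one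
  have hder : HasFDerivAt Ψ (ContinuousLinearMap.id ℂ (ι → ℂ)) 0 := by
    have hO : (fun z => Ψ z - z) =O[𝓝 0] fun z : ι → ℂ => ‖z‖ ^ 2 := isBigO_pi.2 h.tangent
    rw [hasFDerivAt_iff_isLittleO_nhds_zero]
    simp only [zero_add, hΨ0, sub_zero, ContinuousLinearMap.id_apply]
    exact hO.trans_isLittleO (isLittleO_norm_pow_id one_lt_two)
  have hder' : HasFDerivAt Ψ
      ((ContinuousLinearEquiv.refl ℂ (ι → ℂ) : (ι → ℂ) ≃L[ℂ] (ι → ℂ)) : (ι → ℂ) →L[ℂ] (ι → ℂ)) 0 :=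
    hder
  have hstrict : HasStrictFDerivAt Ψ
      ((ContinuousLinearEquiv.refl ℂ (ι → ℂ) : (ι → ℂ) ≃L[ℂ] (ι → ℂ)) : (ι → ℂ) →L[ℂ] (ι → ℂ)) 0 :=
    by simpa [hder'.fderiv] using h.analyticAt.hasStrictFDerivAt
  set Φ := hstrict.localInverse Ψ _ 0 with hΦ
  have hΦ0 : Φ 0 = 0 := by
    have := hstrict.localInverse_apply_image
    rwa [hΨ0] at this
  have hleft : ∀ᶠ z in 𝓝 0, Φ (Ψ z) = z := hstrict.eventually_left_inverse
  have hright : ∀ᶠ z in 𝓝 0, Ψ (Φ z) = z := by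
    have := hstrict.eventually_right_inverse
    rwa [hΨ0] at this
  have hΦd : HasStrictFDerivAt Φ (ContinuousLinearMap.id ℂ (ι → ℂ)) 0 := by
    have := hstrict.to_localInverse
    rw [hΨ0] at this
    exact this
  have hΦa : AnalyticAt ℂ Φ 0 := by
    let R := hstrict.toOpenPartialHomeomorph Ψ
    have hx : (0 : ι → ℂ) ∈ R.source := hstrict.mem_toOpenPartialHomeomorph_source
    obtain ⟨p, hp⟩ := h.analyticAt
    have := R.hasFPowerSeriesAt_symm hx (p := p) (i := ContinuousLinearEquiv.refl ℂ (ι → ℂ)) hp (by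
      rw [← hp.hasFDerivAt.unique hder', LinearIsometryEquiv.symm_apply_apply])
    have h2 := this.analyticAt
    have h3 : R 0 = 0 := hΨ0
    rw [h3] at h2
    exact h2
  have hΦ1 : ∀ j, Vanishes 1 (fun z => Φ z j) := by
    have := hΦd.hasFDerivAt.isBigO_sub
    simp only [hΦ0, sub_zero] at this
    intro j
    have h2 := isBigO_pi.1 this j
    simpa [Vanishes] using h2.norm_right
  refine ⟨fun z => Ψ (F (Φ z)), ?_, ?_, fun j hj => ?_⟩
  · have h1 : AnalyticAt ℂ (fun z => F (Φ z)) 0 :=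
      AnalyticAt.fun_comp (by rwa [hΦ0]) hΦa
    exact AnalyticAt.fun_comp (by rw [hΦ0, hF0]; exact h.analyticAt) h1
  · filter_upwards [hleft] with z hz
    rw [hz]
  · refine ((h.error j hj).comp_pi hΦ1).congr' ?_ Filter.EventuallyEq.rfl
    filter_upwards [hright] with z hz
    rw [hz]

end Conjugacy

section ResonantStep

lemma exists_prod_expansion {ι R : Type*} [CommRing R] (s : Finset ι) (A M : ι → R) (m : ι → ℕ)
    (x : R) :
    ∃ r, ∏ i ∈ s, (1 + A i * x + M i * x ^ 2) ^ m i = 1 + (∑ i ∈ s, m i * A i) * x + r * x ^ 2 := by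
  classical
  have hpow : ∀ (b e : R) (N : ℕ), ∃ r, (1 + b * x + e * x ^ 2) ^ N = 1 + N * b * x + r * x ^ 2 := by
    intro b e N
    induction N with
    | zero => exact ⟨0, by simp⟩
    | succ N ih =>
      obtain ⟨r, hr⟩ := ih
      refine ⟨e + N * b * b + N * b * e * x + r * (1 + b * x + e * x ^ 2), ?_⟩
      rw [pow_succ, hr]
      push_cast
      ring
  induction s using Finset.induction_on with
  | empty => exact ⟨0, by simp⟩
  | insert i s hi ih =>
    obtain ⟨r, hr⟩ := ih
    obtain ⟨r', hr'⟩ := hpow (A i) (M i) (m i)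
    refine ⟨r' + m i * A i * (∑ i ∈ s, m i * A i) + r' * (∑ i ∈ s, m i * A i) * x +
      r * (1 + m i * A i * x + r' * x ^ 2), ?_⟩
    rw [Finset.prod_insert hi, Finset.sum_insert hi, hr, hr']
    ring

variable {ι : Type*} [Fintype ι]

open Polynomial in
/-- The commutator of `x ↦ (1 + A x ^ k + M x ^ (2 * k))` and `x ↦ 1 + c x ^ p`, both acting on
the resonant monomial `x`, has the leading term `x ^ (k + p)`. -/
lemma exists_commutator_expansion {k p : ℕ} (hk : 1 ≤ k) (hp : 1 ≤ p) (A M c : ι → ℂ) (α : ι → ℕ)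
    (j : ι) :
    ∃ W : ℂ[X], ∀ x : ℂ,
      (1 + A j * x ^ k + M j * x ^ (2 * k)) *
          (1 + c j * (x * ∏ i, (1 + A i * x ^ k + M i * x ^ (2 * k)) ^ α i) ^ p) -
        (1 + c j * x ^ p) * (1 + A j * (x * ∏ i, (1 + c i * x ^ p) ^ α i) ^ k +
          M j * (x * ∏ i, (1 + c i * x ^ p) ^ α i) ^ (2 * k)) =
      (p * (∑ i, α i * A i) * c j - k * A j * ∑ i, α i * c i) * x ^ (k + p) +
        x ^ (k + p + 1) * W.eval x := by
  obtain ⟨k, rfl⟩ : ∃ k', k = k' + 1 := ⟨k - 1, by omega⟩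
  obtain ⟨p, rfl⟩ : ∃ p', p = p' + 1 := ⟨p - 1, by omega⟩
  obtain ⟨r, hr⟩ := exists_prod_expansion Finset.univ (fun i => C (A i)) (fun i => C (M i))
    (fun i => α i * (p + 1)) (X ^ (k + 1) : ℂ[X])
  obtain ⟨s, hs⟩ := exists_prod_expansion Finset.univ (fun i => C (c i)) (fun _ => 0)
    (fun i => α i * (k + 1)) (X ^ (p + 1) : ℂ[X])
  set L := ∑ i, (α i : ℂ) * A i with hL
  set T := ∑ i, (α i : ℂ) * c i with hT
  have hr' : ∀ x : ℂ, (∏ i, (1 + A i * x ^ (k + 1) + M i * x ^ (2 * (k + 1))) ^ α i) ^ (p + 1) =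
      1 + (p + 1) * L * x ^ (k + 1) + r.eval x * x ^ (2 * (k + 1)) := by
    intro x
    have := congrArg (eval x) hr
    simp only [eval_prod, eval_pow, eval_add, eval_mul, eval_C, eval_X, eval_one,
      eval_finsetSum, eval_natCast, pow_mul, Finset.prod_pow] at this
    simp only [pow_mul', this, hL, Finset.mul_sum]
    congr 3
    refine Finset.sum_congr rfl fun i _ => ?_
    push_cast
    ring
  have hs' : ∀ x : ℂ, (∏ i, (1 + c i * x ^ (p + 1)) ^ α i) ^ (k + 1) =
      1 + (k + 1) * T * x ^ (p + 1) + s.eval x * x ^ (2 * (p + 1)) := by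
    intro x
    have := congrArg (eval x) hs
    simp only [eval_prod, eval_pow, eval_add, eval_mul, eval_C, eval_X, eval_one,
      eval_finsetSum, eval_natCast, pow_mul, Finset.prod_pow, zero_mul, add_zero] at this
    simp only [pow_mul', this, hT, Finset.mul_sum]
    congr 3
    refine Finset.sum_congr rfl fun i _ => ?_
    push_cast
    ring
  let a : ℂ[X] := X ^ k
  let b : ℂ[X] := X ^ p
  let l : ℂ[X] := C ((p + 1) * L)
  let t : ℂ[X] := C ((k + 1) * T)
  refine ⟨C (c j) * r * a + C (A j) * C (c j) * (l * a + r * X * a ^ 2) +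
    C (M j) * C (c j) * a * (1 + l * X * a + r * X ^ 2 * a ^ 2) -
    (C (A j) * s * b + C (M j) * a * (2 * (t + s * X * b) + X * b * (t + s * X * b) ^ 2) +
      C (c j) * C (A j) * b * (t + s * X * b) +
      C (c j) * C (M j) * a * (1 + t * X * b + s * X ^ 2 * b ^ 2) ^ 2), fun x => ?_⟩
  rw [mul_pow, mul_pow, mul_pow x _ (2 * (k + 1)), pow_mul' (∏ i, (1 + c i * x ^ (p + 1)) ^ α i),
    hr', hs']
  simp only [a, b, l, t, eval_sub, eval_pow, eval_add, eval_mul, eval_C, eval_X, eval_one,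
    eval_ofNat]
  push_cast
  ring

/-- The monomial `z ^ α`. -/
def monom (α : ι → ℕ) (z : ι → ℂ) : ℂ := ∏ i, z i ^ α i

variable {α : ι → ℕ} {S : Finset ι}

lemma prod_pow_resonant [DecidableEq ι] (α : ι → ℕ) (j : ι) (q : ℕ) (z : ι → ℂ) :
    ∏ i, z i ^ (q * α i + if i = j then 1 else 0) = z j * monom α z ^ q := by
  simp only [pow_add, Finset.prod_mul_distrib, monom, ← Finset.prod_pow, ← pow_mul, pow_ite,
    pow_one, pow_zero, Finset.prod_ite_eq', Finset.mem_univ, if_true]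
  rw [mul_comm]
  simp only [mul_comm q]

lemma sum_resonant [DecidableEq ι] (α : ι → ℕ) (j : ι) (q : ℕ) :
    ∑ i, (q * α i + if i = j then 1 else 0) = q * ∑ i, α i + 1 := by
  simp [Finset.sum_add_distrib, Finset.mul_sum]

section

variable {E : Type*} [NormedAddCommGroup E] {f g : E → ι → ℂ} {j : ι}

lemma vanishes_mul_monom_pow (hα : ∀ i ∉ S, α i = 0) (hj : j ∈ S)
    (hf : ∀ i ∈ S, Vanishes 1 (fun z => f z i)) (q : ℕ) :
    Vanishes (q * ∑ i, α i + 1) (fun z => f z j * monom α (f z) ^ q) := by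
  classical
  simp only [← prod_pow_resonant, ← sum_resonant α j]
  refine vanishes_prod_pow _ _ fun i _ hi => hf i ?_
  by_contra hiS
  have : i ≠ j := fun h => hiS (h ▸ hj)
  simp [hα i hiS, this] at hi

lemma vanishes_mul_monom_pow_sub (hα : ∀ i ∉ S, α i = 0) (hj : j ∈ S)
    (hf : ∀ i ∈ S, Vanishes 1 (fun z => f z i)) (hg : ∀ i ∈ S, Vanishes 1 (fun z => g z i))
    {r : ℕ} (hfg : ∀ i ∈ S, Vanishes (r + 1) (fun z => f z i - g z i)) (q : ℕ) :
    Vanishes (q * ∑ i, α i + 1 + r)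
      (fun z => f z j * monom α (f z) ^ q - g z j * monom α (g z) ^ q) := by
  classical
  simp only [← prod_pow_resonant, ← sum_resonant α j]
  have hS : ∀ i, (q * α i + if i = j then 1 else 0) ≠ 0 → i ∈ S := by
    intro i hi
    by_contra hiS
    have : i ≠ j := fun h => hiS (h ▸ hj)
    simp [hα i hiS, this] at hi
  exact vanishes_prod_pow_sub_prod_pow _ _ (fun i _ hi => hf i (hS i hi))
    (fun i _ hi => hg i (hS i hi)) fun i _ hi => hfg i (hS i hi)

end

lemma monom_mul (α : ι → ℕ) (f g : ι → ℂ) :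
    monom α (fun i => f i * g i) = monom α f * monom α g := by
  simp [monom, mul_pow, Finset.prod_mul_distrib]

/-- The effect of the resonant change of coordinates `y_j ↦ y_j (1 + c_j y ^ (p α))` on the
leading part of the conjugacy error. -/
lemma vanishes_error_resonant_change {lam : ι → ℂ} {F Ψ : (ι → ℂ) → ι → ℂ}
    (hα : ∀ i ∉ S, α i = 0) (hlam : monom α lam = 1) (hD : 1 ≤ ∑ i, α i)
    {k p : ℕ} (hk : 1 ≤ k) (hp : 1 ≤ p) {A M B : ι → ℂ} (c : ι → ℂ)
    (hF : ∀ j, Vanishes 1 (fun z => F z j)) (htan : ∀ j, Vanishes 2 (fun z => Ψ z j - z j))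
    (herr : ∀ j ∈ S, Vanishes ((k + p) * (∑ i, α i) + 2) (fun z =>
      Ψ (F z) j - lam j * Ψ z j *
        (1 + A j * monom α (Ψ z) ^ k + M j * monom α (Ψ z) ^ (2 * k)) -
          B j * (z j * monom α z ^ (k + p))))
    {Ψ' : (ι → ℂ) → ι → ℂ} (hΨ' : ∀ z j, Ψ' z j = Ψ z j * (1 + c j * monom α (Ψ z) ^ p))
    {j : ι} (hj : j ∈ S) :
    Vanishes ((k + p) * (∑ i, α i) + 2) (fun z =>
      Ψ' (F z) j - lam j * Ψ' z j *
        (1 + A j * monom α (Ψ' z) ^ k + M j * monom α (Ψ' z) ^ (2 * k)) -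
          (B j + lam j * (p * (∑ i, α i * A i) * c j - k * A j * ∑ i, α i * c i)) *
            (z j * monom α z ^ (k + p))) := by
  set K := p * (∑ i, α i * A i) * c j - k * A j * ∑ i, α i * c i with hK
  obtain ⟨W, hW⟩ := exists_commutator_expansion hk hp A M c α j
  have hΨ1 : ∀ i, Vanishes 1 (fun z => Ψ z i) := fun i => (htan i).one_of_sub (vanishes_coord i)
  have hx : Vanishes 1 (fun z => monom α (Ψ z)) :=
    (vanishes_prod_pow Finset.univ α fun i _ _ => hΨ1 i).mono hD
  have hx0 : ∀ Q : Polynomial ℂ, Vanishes 0 (fun z => Q.eval (monom α (Ψ z))) := by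
    intro Q
    have ht : Filter.Tendsto (fun z => monom α (Ψ z)) (𝓝 0) (𝓝 0) := by
      refine IsBigO.trans_tendsto hx ?_
      have : Continuous fun z : ι → ℂ => ‖z‖ ^ 1 := by fun_prop
      simpa using this.tendsto 0
    have := (Q.continuous.tendsto 0).comp ht
    simpa [Vanishes, Function.comp_def] using this.isBigO_one ℝ
  set N : (ι → ℂ) → ι → ℂ := fun z i => (lam i * Ψ z i) *
    (1 + A i * monom α (Ψ z) ^ k + M i * monom α (Ψ z) ^ (2 * k)) with hN
  have hNU : ∀ z, monom α (N z) = monom α (Ψ z) *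
      ∏ i, (1 + A i * monom α (Ψ z) ^ k + M i * monom α (Ψ z) ^ (2 * k)) ^ α i := by
    intro z
    rw [hN, monom_mul, monom_mul, hlam, one_mul]
    rfl
  have hΨ'U : ∀ z, monom α (Ψ' z) = monom α (Ψ z) *
      ∏ i, (1 + c i * monom α (Ψ z) ^ p) ^ α i := by
    intro z
    rw [show Ψ' z = fun i => Ψ z i * (1 + c i * monom α (Ψ z) ^ p) from funext (hΨ' z), monom_mul]
    rfl
  have hw1 : ∀ i, Vanishes 1 (fun z => Ψ (F z) i) := fun i => (hΨ1 i).comp_pi hF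
  have hwN : ∀ i ∈ S, Vanishes ((k + p) * (∑ i, α i) + 1) (fun z => Ψ (F z) i - N z i) := by
    intro i hi
    have := vanishes_mul_monom_pow hα hi (f := fun z : ι → ℂ => z)
      (fun i _ => vanishes_coord i) (k + p)
    exact (((herr i hi).mono (Nat.le_succ _)).add (this.const_mul (B i))).congr fun z =>
      sub_add_cancel _ _
  have hN1 : ∀ i ∈ S, Vanishes 1 (fun z => N z i) := fun i hi =>
    ((hw1 i).sub ((hwN i hi).mono (Nat.le_add_left 1 _))).congr fun z => sub_sub_cancel _ _
  have h2 : Vanishes ((k + p) * (∑ i, α i) + 2)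
      (fun z => Ψ (F z) j * monom α (Ψ (F z)) ^ p - N z j * monom α (N z) ^ p) := by
    refine (vanishes_mul_monom_pow_sub hα hj (fun i _ => hw1 i) hN1 hwN p).mono ?_
    have : 1 ≤ p * ∑ i, α i := Nat.mul_pos hp hD
    omega
  have h3 : Vanishes ((k + p) * (∑ i, α i) + 2)
      (fun z => Ψ z j * monom α (Ψ z) ^ (k + p) - z j * monom α z ^ (k + p)) :=
    vanishes_mul_monom_pow_sub hα hj (fun i _ => hΨ1 i) (fun i _ => vanishes_coord i)
      (r := 1) (fun i _ => htan i) (k + p)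
  have h4 : Vanishes ((k + p) * (∑ i, α i) + 2)
      (fun z => Ψ z j * monom α (Ψ z) ^ (k + p + 1) * W.eval (monom α (Ψ z))) := by
    refine ((vanishes_mul_monom_pow hα hj (fun i _ => hΨ1 i) (k + p + 1)).mul (hx0 W)).mono ?_
    have : (k + p + 1) * ∑ i, α i = (k + p) * (∑ i, α i) + ∑ i, α i := by ring
    omega
  refine ((((herr j hj).add (h2.const_mul (c j))).add (h3.const_mul (lam j * K))).add
    (h4.const_mul (lam j))).congr fun z => ?_
  have hWz := hW (monom α (Ψ z))
  rw [← hNU, ← hΨ'U, ← hK] at hWz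
  have hNj : N z j = (lam j * Ψ z j) *
    (1 + A j * monom α (Ψ z) ^ k + M j * monom α (Ψ z) ^ (2 * k)) := rfl
  rw [hΨ' (F z) j, hΨ' z j, hNj]
  linear_combination (-lam j * Ψ z j) * hWz

end ResonantStep

section NormalForm

open MvPolynomial

variable {ι : Type*} [Fintype ι]

/-- The polynomial `b z ^ (q α) z_j`. -/
noncomputable def resonantMonomial [DecidableEq ι] (α : ι → ℕ) (j : ι) (q : ℕ) (b : ℂ) : MvPolynomial ι ℂ :=
  monomial (Finsupp.equivFunOnFinite.symm fun i => q * α i + if i = j then 1 else 0) b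

lemma eval_resonantMonomial [DecidableEq ι] (α : ι → ℕ) (j : ι) (q : ℕ) (b : ℂ) (z : ι → ℂ) :
    eval z (resonantMonomial α j q b) = b * (z j * monom α z ^ q) := by
  rw [resonantMonomial, eval_monomial, Finsupp.prod_pow, ← prod_pow_resonant]
  rfl

lemma sum_of_mem_support_resonantMonomial [DecidableEq ι] {α : ι → ℕ} {j : ι} {q : ℕ} {b : ℂ}
    {l : ι →₀ ℕ} (hl : l ∈ (resonantMonomial α j q b).support) :
    ∑ i, l i = q * ∑ i, α i + 1 := by
  rw [Finset.mem_singleton.1 (support_monomial_subset hl), ← sum_resonant α j]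
  rfl

/-- The higher order terms of the formal normal form. -/
noncomputable def normalFormTail [DecidableEq ι] (lam : ι → ℂ) (α : ι → ℕ) (k : ℕ) (a : ι → ℂ) (μ : ℂ) (j : ι) :
    MvPolynomial ι ℂ :=
  resonantMonomial α j k (a j) +
    resonantMonomial α j (2 * k) (μ * α j * ((starRingEnd ℂ) (lam j))⁻¹)

lemma eval_normalFormTail [DecidableEq ι] (lam : ι → ℂ) (α : ι → ℕ) (k : ℕ) (a : ι → ℂ) (μ : ℂ)
    (j : ι) (z : ι → ℂ) :
    eval z (normalFormTail lam α k a μ j) = a j * (z j * monom α z ^ k) +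
      μ * α j * ((starRingEnd ℂ) (lam j))⁻¹ * (z j * monom α z ^ (2 * k)) := by
  simp [normalFormTail, eval_resonantMonomial]

lemma two_le_of_mem_support_normalFormTail [DecidableEq ι] {lam : ι → ℂ} {α : ι → ℕ} {k : ℕ}
    {a : ι → ℂ} {μ : ℂ} {j : ι} (hk : 1 ≤ k) (hD : 1 ≤ ∑ i, α i)
    {l : ι →₀ ℕ} (hl : l ∈ (normalFormTail lam α k a μ j).support) : 2 ≤ ∑ i, l i := by
  have h1 : 1 ≤ k * ∑ i, α i := Nat.mul_pos hk hD
  have h2 : 1 ≤ 2 * k * ∑ i, α i := Nat.mul_pos (by omega) hD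
  rcases Finset.mem_union.1 (support_add hl) with h | h <;>
    rw [sum_of_mem_support_resonantMonomial h] <;> omega

/-- `F` is one-resonant and non-degenerate of order `k` with respect to the eigenvalues with index
in `S`, with index of resonance `α` and leading coefficients `a`. -/
structure IsNondegenerateOneResonant [DecidableEq ι] (lam : ι → ℂ) (S : Finset ι) (α : ι → ℕ)
    (k : ℕ) (a : ι → ℂ) (F : (ι → ℂ) → ι → ℂ) : Prop where
  analyticAt : AnalyticAt ℂ F 0
  linear_part : ∀ j, Vanishes 2 (fun z => F z j - lam j * z j)
  index_eq_zero : ∀ i ∉ S, α i = 0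
  one_le_sum_index : 1 ≤ ∑ i, α i
  monom_eigenvalues : monom α lam = 1
  eigenvalue_ne_zero : ∀ j ∈ S, lam j ≠ 0
  resonance : ∀ j ∈ S, ∀ l : ι → ℕ, 2 ≤ ∑ i, l i → lam j = ∏ i, lam i ^ l i →
    ∃ q : ℕ, l = fun i => q * α i + if i = j then 1 else 0
  one_le_order : 1 ≤ k
  leading_part : ∀ j ∈ S, Vanishes (k * (∑ i, α i) + 2)
    (fun z => F z j - (lam j * z j + a j * (z j * monom α z ^ k)))
  nondegenerate : ∑ i, α i * (a i / lam i) ≠ 0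

lemma exists_resonant_coefficients {Λ : ℂ} (hΛ : Λ ≠ 0) {k p : ℕ} (hp : 1 ≤ p) {α : ι → ℕ}
    {A : ι → ℂ} (hA : ∑ i, α i * A i = Λ) (b : ι → ℂ) (hb : p = k → ∑ i, α i * b i = 0) :
    ∃ c : ι → ℂ, ∀ j, p * Λ * c j - k * A j * ∑ i, α i * c i = b j := by
  have hp0 : (p : ℂ) ≠ 0 := Nat.cast_ne_zero.2 (by omega)
  obtain ⟨s, hs⟩ : ∃ s : ℂ, ∑ i, α i * b i = (p - k) * Λ * s := by
    by_cases hpk : p = k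
    · exact ⟨0, by simp [hb hpk]⟩
    · have : (p : ℂ) - k ≠ 0 := sub_ne_zero.2 (Nat.cast_injective.ne hpk)
      exact ⟨(∑ i, α i * b i) / ((p - k) * Λ), by field_simp⟩
  have hsum : ∑ i, α i * ((b i + k * A i * s) / (p * Λ)) = s := by
    have : ∑ i, α i * ((b i + k * A i * s) / (p * Λ)) =
        (∑ i, α i * b i + k * s * ∑ i, α i * A i) / (p * Λ) := by
      rw [Finset.mul_sum, ← Finset.sum_add_distrib, Finset.sum_div]
      exact Finset.sum_congr rfl fun i _ => by ring
    rw [this, hs, hA]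
    field_simp
    ring
  refine ⟨fun j => (b j + k * A j * s) / (p * Λ), fun j => ?_⟩
  rw [hsum]
  field_simp
  ring

namespace IsNondegenerateOneResonant

variable [DecidableEq ι] {lam : ι → ℂ} {S : Finset ι} {α : ι → ℕ} {k : ℕ} {a : ι → ℂ}
  {F : (ι → ℂ) → ι → ℂ}

lemma sum_sq_ne_zero (H : IsNondegenerateOneResonant lam S α k a F) :
    ∑ i, α i * (α i * ((starRingEnd ℂ) (lam i))⁻¹ / lam i) ≠ 0 := by
  have hterm : ∀ i, α i * (α i * ((starRingEnd ℂ) (lam i))⁻¹ / lam i) =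
      (((α i : ℝ) ^ 2 / Complex.normSq (lam i) : ℝ) : ℂ) := by
    intro i
    push_cast
    rw [Complex.normSq_eq_conj_mul_self, div_eq_mul_inv, div_eq_mul_inv, mul_inv]
    ring
  simp only [hterm, ← Complex.ofReal_sum]
  rw [Complex.ofReal_ne_zero]
  obtain ⟨i, -, hi⟩ : ∃ i ∈ Finset.univ, α i ≠ 0 :=
    Finset.exists_ne_zero_of_sum_ne_zero (Nat.one_le_iff_ne_zero.1 H.one_le_sum_index)
  have hiS : i ∈ S := by
    by_contra h
    exact hi (H.index_eq_zero i h)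
  refine (Finset.sum_pos' (fun i _ => div_nonneg (sq_nonneg _) (Complex.normSq_nonneg _))
    ⟨i, Finset.mem_univ i, div_pos ?_ ?_⟩).ne'
  · exact pow_pos (Nat.cast_pos.2 (Nat.pos_of_ne_zero hi)) 2
  · exact Complex.normSq_pos.2 (H.eigenvalue_ne_zero i hiS)

lemma mem_support_resonant (H : IsNondegenerateOneResonant lam S α k a F) {j : ι} (hj : j ∈ S)
    {d : ℕ} (hd : 2 ≤ d) {g : MvPolynomial ι ℂ} (hg : g.IsHomogeneous d)
    (hgr : IsResonant lam j g) {l : ι →₀ ℕ} (hl : l ∈ g.support) :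
    ∃ q, d = q * (∑ i, α i) + 1 ∧
      l = Finsupp.equivFunOnFinite.symm fun i => q * α i + if i = j then 1 else 0 := by
  have hsum := sum_eq_of_mem_support hg hl
  obtain ⟨q, hq⟩ := H.resonance j hj l (hsum ▸ hd) (hgr l hl)
  refine ⟨q, ?_, DFunLike.coe_injective hq⟩
  rw [← hsum, ← sum_resonant α j, hq]

lemma eq_resonantMonomial (H : IsNondegenerateOneResonant lam S α k a F) {j : ι} (hj : j ∈ S)
    {q : ℕ} (hd : 2 ≤ q * (∑ i, α i) + 1) {g : MvPolynomial ι ℂ}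
    (hg : g.IsHomogeneous (q * (∑ i, α i) + 1)) (hgr : IsResonant lam j g) :
    ∃ b, g = resonantMonomial α j q b := by
  set l₀ : ι →₀ ℕ := Finsupp.equivFunOnFinite.symm fun i => q * α i + if i = j then 1 else 0
    with hl₀
  refine ⟨coeff l₀ g, MvPolynomial.ext _ _ fun l => ?_⟩
  rw [resonantMonomial, coeff_monomial, ← hl₀]
  split_ifs with h
  · rw [h]
  · by_contra hne
    obtain ⟨q', hq', hl⟩ := H.mem_support_resonant hj hd hg hgr (mem_support_iff.2 hne)
    have : q = q' := Nat.eq_of_mul_eq_mul_right H.one_le_sum_index (by omega)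
    subst this
    exact h hl.symm

/-- Improving the conjugacy to the normal form by one order, where the coefficient `μ` is
only modified in degree `2 k |α| + 1`. -/
lemma exists_succ (H : IsNondegenerateOneResonant lam S α k a F) {d : ℕ} {μ : ℂ}
    {Ψ : (ι → ℂ) → ι → ℂ} (h : IsConjugacy lam F S d Ψ (normalFormTail lam α k a μ))
    (hd : k * (∑ i, α i) + 2 ≤ d) :
    ∃ (μ' : ℂ) (Ψ' : (ι → ℂ) → ι → ℂ),
      IsConjugacy lam F S (d + 1) Ψ' (normalFormTail lam α k a μ') ∧
        (d ≠ 2 * k * (∑ i, α i) + 1 → μ' = μ) := by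
  have hk := H.one_le_order
  have hD := H.one_le_sum_index
  have hF1 := vanishes_one_of_linear_part H.linear_part
  have hd2 : 2 ≤ d := by omega
  obtain ⟨Ψ₁, g, h₁, -, hg⟩ := h.exists_resonant_error H.analyticAt H.linear_part hd2
    fun j _ l hl => two_le_of_mem_support_normalFormTail hk hD hl
  by_cases hq : ∃ q, d = q * (∑ i, α i) + 1
  swap
  · refine ⟨μ, Ψ₁, ⟨h₁.analyticAt, h₁.tangent, fun j hj => ?_⟩, fun _ => rfl⟩
    obtain ⟨hg1, hg2, hg3⟩ := hg j hj
    have hg0 : g j = 0 := by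
      rw [← support_eq_empty, Finset.eq_empty_iff_forall_notMem]
      intro l hl
      obtain ⟨q, hq', -⟩ := H.mem_support_resonant hj hd2 hg1 hg2 hl
      exact hq ⟨q, hq'⟩
    simpa [hg0] using hg3
  obtain ⟨q, rfl⟩ := hq
  have hkq : k < q := by
    by_contra! hle
    have := Nat.mul_le_mul_right (∑ i, α i) hle
    omega
  obtain ⟨p, rfl⟩ : ∃ p, q = k + p := ⟨q - k, by omega⟩
  have hp : 1 ≤ p := by omega
  have hB : ∀ j, ∃ b, j ∈ S → g j = resonantMonomial α j (k + p) b := by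
    intro j
    by_cases hj : j ∈ S
    · obtain ⟨b, hb⟩ := H.eq_resonantMonomial hj hd2 (hg j hj).1 (hg j hj).2.1
      exact ⟨b, fun _ => hb⟩
    · exact ⟨0, fun h => absurd h hj⟩
  choose B hB using hB
  let T : ℂ := ∑ i, α i * (α i * ((starRingEnd ℂ) (lam i))⁻¹ / lam i)
  have hT : T ≠ 0 := H.sum_sq_ne_zero
  obtain ⟨δ, hδ, hδT⟩ : ∃ δ : ℂ, (p ≠ k → δ = 0) ∧
      (p = k → ∑ i, α i * (B i / lam i) = δ * T) := by
    by_cases hpk : p = k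
    · exact ⟨(∑ i, α i * (B i / lam i)) / T, fun h => absurd hpk h,
        fun _ => (div_mul_cancel₀ _ hT).symm⟩
    · exact ⟨0, fun _ => rfl, fun h => absurd h hpk⟩
  let B' : ι → ℂ := fun i => B i - δ * α i * ((starRingEnd ℂ) (lam i))⁻¹
  obtain ⟨c, hc⟩ := exists_resonant_coefficients (k := k) H.nondegenerate hp rfl
    (fun i => -B' i / lam i) (fun hpk => by
      have : ∑ i, α i * (-B' i / lam i) = δ * T - ∑ i, α i * (B i / lam i) := by
        rw [Finset.mul_sum, ← Finset.sum_sub_distrib]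
        exact Finset.sum_congr rfl fun i _ => by ring
      rw [this, hδT hpk, sub_self])
  let M : ι → ℂ := fun i => (μ + δ) * α i * ((starRingEnd ℂ) (lam i))⁻¹ / lam i
  have hnf : ∀ j ∈ S, ∀ y : ι → ℂ,
      lam j * y j + eval y (normalFormTail lam α k a (μ + δ) j) = lam j * y j *
        (1 + a j / lam j * monom α y ^ k + M j * monom α y ^ (2 * k)) := by
    intro j hj y
    have := H.eigenvalue_ne_zero j hj
    rw [eval_normalFormTail]
    simp only [M]
    field_simp
    ring
  let Ψ₂ : (ι → ℂ) → ι → ℂ := fun z j => Ψ₁ z j * (1 + c j * monom α (Ψ₁ z) ^ p)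
  have hΨ₂ : ∀ z j, Ψ₂ z j = Ψ₁ z j + eval (Ψ₁ z) (resonantMonomial α j p (c j)) := by
    intro z j
    rw [eval_resonantMonomial]
    ring
  have herr : ∀ j ∈ S, Vanishes ((k + p) * (∑ i, α i) + 2) (fun z =>
      Ψ₁ (F z) j - lam j * Ψ₁ z j *
        (1 + a j / lam j * monom α (Ψ₁ z) ^ k + M j * monom α (Ψ₁ z) ^ (2 * k)) -
          B' j * (z j * monom α z ^ (k + p))) := by
    intro j hj
    have h3 : Vanishes ((k + p) * (∑ i, α i) + 2) (fun z =>
        δ * (Ψ₁ z j * monom α (Ψ₁ z) ^ (2 * k) - z j * monom α z ^ (k + p))) := by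
      by_cases hpk : p = k
      · subst hpk
        have := vanishes_mul_monom_pow_sub (r := 1) H.index_eq_zero hj
          (fun i _ => h₁.vanishes_one i) (fun i _ => vanishes_coord i)
          (fun i _ => h₁.tangent i) (p + p)
        rw [two_mul]
        exact this.const_mul δ
      · simpa [hδ hpk] using Vanishes.zero (E := ι → ℂ) ((k + p) * (∑ i, α i) + 2)
    refine ((hg j hj).2.2.sub (h3.const_mul (α j * ((starRingEnd ℂ) (lam j))⁻¹))).congr
      fun z => ?_
    rw [← hnf j hj, hB j hj, eval_resonantMonomial, eval_normalFormTail, eval_normalFormTail]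
    simp only [B']
    ring
  refine ⟨μ + δ, Ψ₂, ⟨?_, fun j => ?_, fun j hj => ?_⟩, fun hne => ?_⟩
  · refine analyticAt_pi_iff.2 fun j => ?_
    exact ((analyticAt_pi_iff.1 h₁.analyticAt j).fun_add (analyticAt_eval _ h₁.analyticAt)).congr
      (Filter.Eventually.of_forall fun z => (hΨ₂ z j).symm)
  · have h4 : Vanishes 2 (fun z => eval (Ψ₁ z) (resonantMonomial α j p (c j))) := by
      refine vanishes_eval (fun l hl => ?_) h₁.vanishes_one
      rw [sum_of_mem_support_resonantMonomial hl]
      have : 1 ≤ p * ∑ i, α i := Nat.mul_pos hp hD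
      omega
    refine ((h₁.tangent j).add h4).congr fun z => ?_
    rw [hΨ₂]
    ring
  · refine (vanishes_error_resonant_change H.index_eq_zero H.monom_eigenvalues hD hk hp c hF1
      h₁.tangent herr (Ψ' := Ψ₂) (fun _ _ => rfl) hj).congr fun z => ?_
    have := H.eigenvalue_ne_zero j hj
    rw [hc j, hnf j hj, show B' j + lam j * (-B' j / lam j) = 0 by field_simp; ring, zero_mul,
      sub_zero]
  · rw [hδ, add_zero]
    rintro rfl
    exact hne (by ring)

/-- The formal normal form of the components with index in `S`. -/
lemma exists_isConjugacy (H : IsNondegenerateOneResonant lam S α k a F) :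
    ∃ μ : ℂ, ∀ d, ∃ Ψ, IsConjugacy lam F S d Ψ (normalFormTail lam α k a μ) := by
  have h1 : 1 ≤ k * ∑ i, α i := Nat.mul_pos H.one_le_order H.one_le_sum_index
  have h2 : 2 * k * ∑ i, α i = k * (∑ i, α i) + k * (∑ i, α i) := by ring
  have hlow : ∀ d, k * (∑ i, α i) + 2 ≤ d → d ≤ 2 * k * (∑ i, α i) + 1 →
      ∃ Ψ, IsConjugacy lam F S d Ψ (normalFormTail lam α k a 0) := by
    intro d hd
    induction d, hd using Nat.le_induction with
    | base =>
      refine fun _ => ⟨id, analyticAt_id, fun j => ?_, fun j hj => ?_⟩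
      · simpa using Vanishes.zero (E := ι → ℂ) 2
      · refine (H.leading_part j hj).congr fun z => ?_
        rw [eval_normalFormTail]
        simp
    | succ d hd ih =>
      intro hle
      obtain ⟨Ψ, hΨ⟩ := ih (by omega)
      obtain ⟨μ, Ψ', hΨ', hμ⟩ := H.exists_succ hΨ hd
      rw [hμ (by omega)] at hΨ'
      exact ⟨Ψ', hΨ'⟩
  obtain ⟨Ψ₀, hΨ₀⟩ := hlow (2 * k * (∑ i, α i) + 1) (by omega) le_rfl
  obtain ⟨μ, Ψ₁, hΨ₁, -⟩ := H.exists_succ hΨ₀ (by omega)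
  have hhigh : ∀ d, 2 * k * (∑ i, α i) + 2 ≤ d →
      ∃ Ψ, IsConjugacy lam F S d Ψ (normalFormTail lam α k a μ) := by
    intro d hd
    induction d, hd using Nat.le_induction with
    | base => exact ⟨Ψ₁, hΨ₁⟩
    | succ d hd ih =>
      obtain ⟨Ψ, hΨ⟩ := ih
      obtain ⟨μ', Ψ', hΨ', hμ⟩ := H.exists_succ hΨ (by omega)
      rw [hμ (by omega)] at hΨ'
      exact ⟨Ψ', hΨ'⟩
  refine ⟨μ, fun d => ?_⟩
  obtain ⟨Ψ, hΨ⟩ := hhigh (max d (2 * k * (∑ i, α i) + 2)) (le_max_right _ _)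
  exact ⟨Ψ, hΨ.mono (le_max_left _ _)⟩

end IsNondegenerateOneResonant

end NormalForm

end OneResonant

/-- **Formal normal form for non-degenerate one-resonant diffeomorphisms (Theorem 3.6).**
Let `F ∈ Diff(ℂⁿ;0)` be one-resonant with respect to `{λ₁,…,λ_m}` with index of resonance
`α`, in Poincaré–Dulac prenormal form `F_j(z) = λ_j z_j + a_j z^{kα} z_j + O(|z|^{|α|k+2})`
for `j < m` with `a ≠ 0`, and non-degenerate (`Λ(F) = Σ_{j<m} a_j α_j / λ_j ≠ 0`).  Then
there exists `μ ∈ ℂ` such that `F` is formally conjugated to the map `F̂` with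
`F̂_j(z) = λ_j z_j + a_j z^{kα} z_j + μ α_j (conj λ_j)⁻¹ z^{2kα} z_j` for `j < m`, and whose
components `F̂_j` for `j ≥ m` contain only resonant monomials (monomials `z^l` with
`λ_j = λ^l`).  Formal conjugation is formalized order by order: for every `t` there is a
change of coordinates `Ψ(z) = z + O(|z|²)` conjugating `F` to a germ `G` agreeing with `F̂`
up to `O(|z|^t)`.  (Indices are 0-based: `j < m` are the first `m` components.) -/
theorem one_resonant_formal_normal_form
    (n m : ℕ) (hm : 1 ≤ m) (hmn : m ≤ n)
    (lam : Fin n → ℂ)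
    (F : (Fin n → ℂ) → (Fin n → ℂ))
    (hF : AnalyticAt ℂ F 0) (hF0 : F 0 = 0)
    (hdiag : ∀ j : Fin n,
      (fun z : Fin n → ℂ => F z j - lam j * z j) =O[nhds 0] fun z : Fin n → ℂ => ‖z‖ ^ 2)
    -- one-resonance with respect to the first `m` eigenvalues, with index of resonance `α`
    (α : Fin n → ℕ) (hα0 : α ≠ 0)
    (hαm : ∀ j : Fin n, m ≤ (j : ℕ) → α j = 0)
    (hres : ∀ j : Fin n, (j : ℕ) < m →
      ∀ l : Fin n → ℕ,
        (2 ≤ ∑ i, l i ∧ lam j = ∏ i, lam i ^ l i) ↔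
          (∃ q : ℕ, 1 ≤ q ∧ l = fun i => q * α i + if i = j then 1 else 0))
    -- Poincaré–Dulac prenormal form of order `k` with coefficients `a_j`
    (k : ℕ) (hk : 1 ≤ k) (a : Fin n → ℂ)
    (ha : ∃ j : Fin n, (j : ℕ) < m ∧ a j ≠ 0)
    (hform : ∀ j : Fin n, (j : ℕ) < m →
      (fun z : Fin n → ℂ =>
          F z j - (lam j * z j + a j * (∏ i, z i ^ (k * α i)) * z j))
        =O[nhds 0] fun z : Fin n → ℂ => ‖z‖ ^ ((∑ i, α i) * k + 2))
    -- non-degeneracy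
    (hLam0 : (∑ j ∈ Finset.univ.filter (fun j : Fin n => (j : ℕ) < m),
        a j * (α j : ℂ) / lam j) ≠ 0) :
    ∃ μ : ℂ, ∀ t : ℕ, ∃ Ψ G : (Fin n → ℂ) → (Fin n → ℂ),
      AnalyticAt ℂ Ψ 0 ∧ Ψ 0 = 0 ∧
      ((fun z : Fin n → ℂ => Ψ z - z) =O[nhds 0] fun z : Fin n → ℂ => ‖z‖ ^ 2) ∧
      AnalyticAt ℂ G 0 ∧ (∀ᶠ z in nhds (0 : Fin n → ℂ), Ψ (F z) = G (Ψ z)) ∧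
      (∀ j : Fin n, (j : ℕ) < m →
        (fun z : Fin n → ℂ =>
            G z j - (lam j * z j + a j * (∏ i, z i ^ (k * α i)) * z j
              + μ * (α j : ℂ) * ((starRingEnd ℂ) (lam j))⁻¹
                * (∏ i, z i ^ (2 * k * α i)) * z j))
          =O[nhds 0] fun z : Fin n → ℂ => ‖z‖ ^ t) ∧
      (∀ j : Fin n, m ≤ (j : ℕ) →
        ∃ P : MvPolynomial (Fin n) ℂ,
          (∀ l ∈ P.support, l ≠ 0 ∧ lam j = ∏ i, lam i ^ (l i)) ∧
          ((fun z : Fin n → ℂ => G z j - MvPolynomial.eval z P)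
            =O[nhds 0] fun z : Fin n → ℂ => ‖z‖ ^ t)) := by
  classical
  let S : Finset (Fin n) := Finset.univ.filter fun j : Fin n => (j : ℕ) < m
  have hS : ∀ j, j ∈ S ↔ (j : ℕ) < m := fun j => by simp [S]
  have hmon : ∀ (q : ℕ) (z : Fin n → ℂ), ∏ i, z i ^ (q * α i) = OneResonant.monom α z ^ q := by
    intro q z
    simp only [OneResonant.monom, ← Finset.prod_pow, ← pow_mul, mul_comm q]
  have hαS : ∀ i ∉ S, α i = 0 := fun i hi => hαm i (not_lt.1 fun h => hi ((hS i).2 h))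
  have hD : 1 ≤ ∑ i, α i := by
    obtain ⟨i, hi⟩ := Function.ne_iff.1 hα0
    exact (Nat.one_le_iff_ne_zero.2 hi).trans
      (Finset.single_le_sum (fun _ _ => Nat.zero_le _) (Finset.mem_univ i))
  have hsum : ∑ i, α i * (a i / lam i) ≠ 0 := by
    convert hLam0 using 1
    refine (Finset.sum_subset_zero_on_sdiff (Finset.subset_univ S) (fun i hi => ?_)
      fun i _ => by ring).symm
    simp [hαS i (Finset.mem_sdiff.1 hi).2]
  have hlam : ∀ j ∈ S, lam j ≠ 0 := by
    intro j hj h0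
    obtain ⟨q, hq, hl⟩ := (hres j ((hS j).1 hj) fun i => if i = j then 2 else 0).1
      ⟨by simp, by simp [h0, pow_ite, Finset.prod_ite_eq']⟩
    refine hsum (Finset.sum_eq_zero fun i _ => ?_)
    by_cases hij : i = j
    · simp [hij, h0]
    · have := congrFun hl i
      simp only [if_neg hij] at this
      have h1 : α i = 0 := by
        rcases Nat.mul_eq_zero.1 this.symm with h | h <;> omega
      simp [h1]
  have hj₀ : (⟨0, by omega⟩ : Fin n) ∈ S := (hS _).2 (Nat.pos_of_ne_zero (by omega))
  have hprod : OneResonant.monom α lam = 1 := by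
    have h1 := ((hres _ ((hS _).1 hj₀) _).2 ⟨1, le_rfl, rfl⟩).2
    rw [OneResonant.prod_pow_resonant, pow_one] at h1
    exact mul_left_cancel₀ (hlam _ hj₀) (h1.symm.trans (mul_one _).symm)
  have H : OneResonant.IsNondegenerateOneResonant lam S α k a F :=
    { analyticAt := hF
      linear_part := hdiag
      index_eq_zero := hαS
      one_le_sum_index := hD
      monom_eigenvalues := hprod
      eigenvalue_ne_zero := hlam
      resonance := fun j hj l hl hr => by
        obtain ⟨q, -, hq⟩ := (hres j ((hS j).1 hj) l).1 ⟨hl, hr⟩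
        exact ⟨q, hq⟩
      one_le_order := hk
      leading_part := fun j hj => by
        have h1 := hform j ((hS j).1 hj)
        rw [mul_comm _ k] at h1
        refine OneResonant.Vanishes.congr h1 fun z => ?_
        rw [hmon]
        ring
      nondegenerate := hsum }
  obtain ⟨μ, hμ⟩ := H.exists_isConjugacy
  refine ⟨μ, fun t => ?_⟩
  obtain ⟨Ψ₀, hΨ₀⟩ := hμ t
  obtain ⟨Ψ, Q, hΨ, hQS, hQ⟩ := hΨ₀.exists_extend hF hdiag fun j hj y y' hyy' => by
    have hy : OneResonant.monom α y = OneResonant.monom α y' := by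
      refine Finset.prod_congr rfl fun i _ => ?_
      by_cases hi : i ∈ S
      · rw [hyy' i hi]
      · simp [hαS i hi]
    rw [OneResonant.eval_normalFormTail, OneResonant.eval_normalFormTail, hy, hyy' j hj]
  obtain ⟨G, hG, hconj, hGQ⟩ := hΨ.exists_conjugate hF hdiag
  refine ⟨Ψ, G, hΨ.analyticAt, OneResonant.apply_zero_of_vanishes hΨ.vanishes_one,
    Asymptotics.isBigO_pi.2 hΨ.tangent, hG, hconj, fun j hj => ?_, fun j hj => ?_⟩
  · refine OneResonant.Vanishes.congr (hGQ j (Set.mem_univ j)) fun z => ?_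
    rw [hQS j ((hS j).2 hj), OneResonant.eval_normalFormTail, hmon, hmon]
    ring
  · obtain ⟨hr, h2⟩ := hQ j fun h => absurd ((hS j).1 h) (not_lt.2 hj)
    refine ⟨MvPolynomial.monomial (Finsupp.single j 1) (lam j) + Q j, fun l hl => ?_, ?_⟩
    · rcases Finset.mem_union.1 (MvPolynomial.support_add hl) with h | h
      · rw [Finset.mem_singleton.1 (MvPolynomial.support_monomial_subset h)]
        refine ⟨by simp, ?_⟩
        simp [Finsupp.single_apply, pow_ite, Finset.prod_ite_eq]
      · refine ⟨?_, hr l h⟩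
        rintro rfl
        simpa using h2 0 h
    · refine OneResonant.Vanishes.congr (hGQ j (Set.mem_univ j)) fun z => ?_
      rw [map_add, MvPolynomial.eval_monomial, Finsupp.prod_single_index (h := fun i e => z i ^ e) (pow_zero _), pow_one]
end

section
/- Let F be a quasi-parabolic germ of holomorphic diffeomorphism of ℂ² at 0, i.e., F(z,w) = (z + O(|(z,w)|²), e^{2πiθ} w + O(|(z,w)|²)) with θ ∈ ℝ∖ℚ. Then ν(F) = +∞ if and only if there exists a germ of a holomorphic curve through 0 that consists of fixed points of F. -/
open Filter

open Asymptotics Topology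

/-- A map agreeing with a continuous linear map up to `O(‖p‖ ^ 2)` is differentiable at `0`. -/
lemma hasFDerivAt_zero_of_sub_isBigO_sq {E : Type*} [NormedAddCommGroup E] [NormedSpace ℂ E]
    {H : E → E} {L : E →L[ℂ] E} (h : (fun p => H p - L p) =O[𝓝 0] fun p => ‖p‖ ^ 2) :
    HasFDerivAt H L 0 := by
  have h' : (fun p => H p - L p) =O[𝓝 0] fun p : E => ‖p - 0‖ ^ 2 := by simpa using h
  have := (h'.hasFDerivAt one_lt_two).add L.hasFDerivAt
  rw [zero_add] at this
  exact this.congr_of_eventuallyEq (Eventually.of_forall fun p => by simp)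

/-- A coefficient `c = lim g` vanishes if `u ^ n * g = O(u ^ (n + 1))` with `u → 0`, `u ≠ 0`. -/
lemma eq_zero_of_pow_mul_isBigO_pow_succ {α : Type*} {l : Filter α} [l.NeBot] {u g : α → ℂ}
    {c : ℂ} {n : ℕ} (hu : Tendsto u l (𝓝[≠] 0)) (hg : Tendsto g l (𝓝 c))
    (h : (fun x => u x ^ n * g x) =O[l] fun x => u x ^ (n + 1)) : c = 0 := by
  have hu0 : ∀ᶠ x in l, u x ≠ 0 := hu.eventually self_mem_nhdsWithin
  have hgu : g =O[l] u := by
    obtain ⟨C, hC⟩ := h.bound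
    refine IsBigO.of_bound C ?_
    filter_upwards [hC, hu0] with x hx hx0
    have hpos : 0 < ‖u x‖ ^ n := by positivity
    rw [norm_mul, norm_pow, norm_pow, pow_succ] at hx
    exact le_of_mul_le_mul_left (by linarith) hpos
  exact tendsto_nhds_unique hg (hgu.trans_tendsto (tendsto_nhds_of_tendsto_nhdsWithin hu))

/-- An analytic function vanishing to every order at `0` vanishes near `0`. -/
lemma AnalyticAt.eventually_eq_zero_of_isBigO_pow {f : ℂ → ℂ} (hf : AnalyticAt ℂ f 0)
    (h : ∀ t : ℕ, f =O[𝓝 0] fun z => z ^ t) : ∀ᶠ z in 𝓝 0, f z = 0 := by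
  by_contra hne
  obtain ⟨n, g, hg, hg0, hfg⟩ := hf.exists_eventuallyEq_pow_smul_nonzero_iff.mpr hne
  refine hg0 (eq_zero_of_pow_mul_isBigO_pow_succ (l := 𝓝[≠] 0) (u := id) (n := n) tendsto_id
    (hg.continuousAt.tendsto.mono_left nhdsWithin_le_nhds) ?_)
  refine (((h (n + 1)).congr' (hfg.mono fun z hz => ?_) EventuallyEq.rfl).mono nhdsWithin_le_nhds)
  simpa using hz

/-- The analytic inverse function theorem at the origin. -/
lemma AnalyticAt.exists_analyticAt_rightInverse {E : Type*} [NormedAddCommGroup E]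
    [NormedSpace ℂ E] [CompleteSpace E] {H : E → E} {L : E ≃L[ℂ] E} (hH : AnalyticAt ℂ H 0)
    (hL : HasFDerivAt H (L : E →L[ℂ] E) 0) (h0 : H 0 = 0) :
    ∃ g : E → E, AnalyticAt ℂ g 0 ∧ g 0 = 0 ∧ ∀ᶠ y in 𝓝 0, H (g y) = y := by
  have hc : ContDiffAt ℂ ⊤ H 0 := hH.contDiffAt
  have hs := hc.hasStrictFDerivAt' hL (by simp)
  refine ⟨hc.localInverse hL (by simp), ?_, ?_, ?_⟩
  · have := hc.to_localInverse hL (by simp)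
    rw [h0] at this
    exact this.analyticAt
  · simpa [h0] using hc.localInverse_apply_image hL (by simp)
  · have := hs.eventually_right_inverse
    rwa [h0] at this

lemma exp_two_pi_I_mul_ne_one {θ : ℝ} (hθ : Irrational θ) :
    Complex.exp (2 * Real.pi * Complex.I * θ) ≠ 1 := by
  intro h
  obtain ⟨n, hn⟩ := Complex.exp_eq_one_iff.mp h
  refine hθ ⟨n, ?_⟩
  rw [mul_comm (n : ℂ)] at hn
  have := mul_left_cancel₀ Complex.two_pi_I_ne_zero hn
  exact_mod_cast this.symm

/-- A germ whose linear part is `diag(1, l)`, `l ≠ 1`, preserves the second coordinate along some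
analytic curve that is a graph over the first axis. -/
lemma exists_analyticAt_graph_snd_fixed {F : ℂ × ℂ → ℂ × ℂ} {l : ℂ} (hl : l ≠ 1)
    (hF : AnalyticAt ℂ F 0) (hF0 : F 0 = 0)
    (hqp : (fun p : ℂ × ℂ => F p - (p.1, l * p.2)) =O[𝓝 0] fun p : ℂ × ℂ => ‖p‖ ^ 2) :
    ∃ γ : ℂ → ℂ × ℂ, AnalyticAt ℂ γ 0 ∧ γ 0 = 0 ∧
      (∀ᶠ z in 𝓝 0, (γ z).1 = z) ∧ ∀ᶠ z in 𝓝 0, (F (γ z)).2 = (γ z).2 := by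
  let H : ℂ × ℂ → ℂ × ℂ := fun p => (p.1, (F p).2 - p.2)
  let L : (ℂ × ℂ) ≃L[ℂ] (ℂ × ℂ) := (ContinuousLinearEquiv.refl ℂ ℂ).prodCongr
    (ContinuousLinearEquiv.smulLeft (Units.mk0 (l - 1) (sub_ne_zero.mpr hl)))
  have hH : AnalyticAt ℂ H 0 :=
    analyticAt_fst.prod ((analyticAt_snd.comp hF).sub analyticAt_snd)
  have hH0 : H 0 = 0 := by simp [H, hF0]
  have hbound : (fun p => H p - L p) =O[𝓝 0] fun p : ℂ × ℂ => ‖p‖ ^ 2 := by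
    have h2 : (fun p : ℂ × ℂ => (F p - (p.1, l * p.2)).2) =O[𝓝 0] fun p : ℂ × ℂ => ‖p‖ ^ 2 :=
      isBigO_snd_prod'.trans hqp
    refine (IsBigO.prod_left (isBigO_zero (E' := ℂ) _ _) h2).congr_left fun p => ?_
    ext
    · simp [H, L]
    · simp [H, L, Units.smul_def]
      ring
  have hL : HasFDerivAt H (L : ℂ × ℂ →L[ℂ] ℂ × ℂ) 0 :=
    hasFDerivAt_zero_of_sub_isBigO_sq hbound
  obtain ⟨g, hg, hg0, hHg⟩ := hH.exists_analyticAt_rightInverse hL hH0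
  have hι : AnalyticAt ℂ (fun z : ℂ => (z, (0 : ℂ))) 0 := analyticAt_id.prod analyticAt_const
  have hHγ : ∀ᶠ z : ℂ in 𝓝 0, H (g (z, 0)) = (z, 0) := hι.continuousAt.eventually hHg
  refine ⟨fun z => g (z, 0), AnalyticAt.comp (g := g) hg hι, hg0, ?_, ?_⟩
  · filter_upwards [hHγ] with z hz using congrArg Prod.fst hz
  · filter_upwards [hHγ] with z hz using sub_eq_zero.mp (congrArg Prod.snd hz)

/-- If the fixed points of `G` accumulate at `0`, where `G` agrees to order `n + 1` with a
normal form whose first component is `z + a_n z ^ n + O(z ^ (n + 1))`, then `a_n = 0`. -/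
lemma coeff_eq_zero_of_fixed_points {G : ℂ × ℂ → ℂ × ℂ} {l : ℂ} (hl : l ≠ 1) {a b : ℕ → ℂ}
    (hb0 : b 0 = 0) {n : ℕ} (hn : 1 ≤ n) (ha : ∀ j < n, a j = 0)
    (hG : (fun p : ℂ × ℂ => G p -
          (p.1 + ∑ j ∈ Finset.range (n + 1), a j * p.1 ^ j,
           l * p.2 + (∑ j ∈ Finset.range (n + 1), b j * p.1 ^ j) * p.2))
        =O[𝓝 0] fun p : ℂ × ℂ => ‖p‖ ^ (n + 1))
    {α : Type*} {f : Filter α} [f.NeBot] {q : α → ℂ × ℂ} (hq : Tendsto q f (𝓝[≠] 0))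
    (hfix : ∀ᶠ x in f, G (q x) = q x) : a n = 0 := by
  have hq0 : Tendsto q f (𝓝 0) := tendsto_nhds_of_tendsto_nhdsWithin hq
  have hne : ∀ᶠ x in f, q x ≠ 0 := hq.eventually self_mem_nhdsWithin
  have hu : Tendsto (fun x => (q x).1) f (𝓝 0) := (continuous_fst.tendsto _).comp hq0
  have hGq : (fun x => (-(a n * (q x).1 ^ n),
      (1 - l - ∑ j ∈ Finset.range (n + 1), b j * (q x).1 ^ j) * (q x).2))
        =O[f] fun x => ‖q x‖ ^ (n + 1) := by
    refine (hG.comp_tendsto hq0).congr' ?_ EventuallyEq.rfl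
    filter_upwards [hfix] with x hx
    have hsum : ∑ j ∈ Finset.range (n + 1), a j * (q x).1 ^ j = a n * (q x).1 ^ n := by
      rw [Finset.sum_range_succ, Finset.sum_eq_zero, zero_add]
      intro j hj
      simp [ha j (Finset.mem_range.mp hj)]
    ext
    · simp [hx, hsum]
    · simp only [Function.comp, hx, Prod.snd_sub]
      ring
  rw [isBigO_prod_left] at hGq
  obtain ⟨h1, h2⟩ := hGq
  have hlim : Tendsto (fun x => 1 - l - ∑ j ∈ Finset.range (n + 1), b j * (q x).1 ^ j) f
      (𝓝 (1 - l)) := by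
    have hc : Continuous fun z : ℂ => 1 - l - ∑ j ∈ Finset.range (n + 1), b j * z ^ j := by
      fun_prop
    have := (hc.tendsto 0).comp hu
    simpa [Finset.sum_range_succ', hb0, Function.comp_def] using this
  have hl' : 1 - l ≠ 0 := sub_ne_zero.mpr hl.symm
  have hv : (fun x => (q x).2) =O[f] fun x => ‖q x‖ ^ (n + 1) := by
    have := (hlim.inv₀ hl').isBigO_one ℝ |>.mul h2
    refine this.congr' ?_ (Eventually.of_forall fun x => ?_)
    · filter_upwards [hlim.eventually_ne hl'] with x hx
      field_simp
    · simp
  have hv' : (fun x => (q x).2) =o[f] q := by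
    refine hv.trans_isLittleO (IsLittleO.of_norm_right ?_)
    simpa [Function.comp_def] using ((isLittleO_pow_pow (𝕜 := ℝ) (m := 1) (n := n + 1)
      (by omega)).comp_tendsto (tendsto_norm_zero.comp hq0))
  have hnorm : ∀ᶠ x in f, ‖q x‖ = ‖(q x).1‖ := by
    filter_upwards [hv'.bound (show (0 : ℝ) < 1 / 2 by norm_num), hne] with x hx hx0
    have hpos : 0 < ‖q x‖ := norm_pos_iff.mpr hx0
    rcases max_choice ‖(q x).1‖ ‖(q x).2‖ with h | h
    · rw [Prod.norm_def, h]
    · rw [← Prod.norm_def] at h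
      linarith
  have hu' : Tendsto (fun x => (q x).1) f (𝓝[≠] 0) := by
    refine tendsto_nhdsWithin_iff.mpr ⟨hu, ?_⟩
    filter_upwards [hnorm, hne] with x hx hx0 h0
    exact hx0 (norm_eq_zero.mp (by rw [hx, h0, norm_zero]))
  refine eq_zero_of_pow_mul_isBigO_pow_succ (n := n) hu' (tendsto_const_nhds (x := a n)) ?_
  refine IsBigO.of_norm_right ((h1.neg_left).congr' ?_ ?_)
  · exact Eventually.of_forall fun x => by simp [mul_comm]
  · filter_upwards [hnorm] with x hx
    rw [hx, norm_pow]

/-- If `F` is conjugated by a tangent-to-identity `Ψ` to a germ `G` preserving the first coordinate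
to order `t`, then `F - id` is `O(z ^ t)` along any analytic curve along which `F` preserves the
second coordinate. -/
lemma fst_sub_isBigO_pow_of_conj {F Ψ G : ℂ × ℂ → ℂ × ℂ} {γ : ℂ → ℂ × ℂ} {t : ℕ}
    (hF : ContinuousAt F 0) (hF0 : F 0 = 0)
    (hΨ : AnalyticAt ℂ Ψ 0) (hΨ0 : Ψ 0 = 0)
    (hΨid : (fun p : ℂ × ℂ => Ψ p - p) =O[𝓝 0] fun p : ℂ × ℂ => ‖p‖ ^ 2)
    (hconj : ∀ᶠ p in 𝓝 (0 : ℂ × ℂ), Ψ (F p) = G (Ψ p))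
    (hG : (fun p : ℂ × ℂ => (G p).1 - p.1) =O[𝓝 0] fun p : ℂ × ℂ => ‖p‖ ^ t)
    (hγ : AnalyticAt ℂ γ 0) (hγ0 : γ 0 = 0)
    (hsnd : ∀ᶠ z in 𝓝 0, (F (γ z)).2 = (γ z).2) :
    (fun z => (F (γ z)).1 - (γ z).1) =O[𝓝 0] fun z => z ^ t := by
  have hγt : Tendsto γ (𝓝 0) (𝓝 0) := by simpa [hγ0] using hγ.continuousAt.tendsto
  have hFt : Tendsto F (𝓝 0) (𝓝 0) := by simpa [hF0] using hF.tendsto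
  have hΨt : Tendsto Ψ (𝓝 0) (𝓝 0) := by simpa [hΨ0] using hΨ.continuousAt.tendsto
  have hγO : γ =O[𝓝 0] fun z => z := by
    simpa [hγ0] using hγ.differentiableAt.isBigO_sub
  have hΨO : Ψ =O[𝓝 0] fun p => p := by
    simpa [hΨ0] using hΨ.differentiableAt.isBigO_sub
  have hΨd : HasFDerivAt Ψ (ContinuousLinearMap.id ℂ (ℂ × ℂ)) 0 :=
    hasFDerivAt_zero_of_sub_isBigO_sq hΨid
  have hstrict := hΨ.hasStrictFDerivAt
  rw [hΨd.fderiv] at hstrict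
  have hpair : Tendsto (fun z => (F (γ z), γ z)) (𝓝 0) (𝓝 ((0 : ℂ × ℂ), (0 : ℂ × ℂ))) :=
    (hFt.comp hγt).prodMk_nhds hγt
  have hlo := hstrict.isLittleO.comp_tendsto hpair
  have hD : (fun z => F (γ z) - γ z) =O[𝓝 0] fun z => (F (γ z)).1 - (γ z).1 := by
    refine IsBigO.of_bound 1 ?_
    filter_upwards [hsnd] with z hz
    simp [Prod.norm_def, hz]
  have hequiv : (fun z => (Ψ (F (γ z))).1 - (Ψ (γ z)).1) ~[𝓝 0]
      fun z => (F (γ z)).1 - (γ z).1 := by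
    have h := isBigO_fst_prod' (l := 𝓝 0) (f' := fun z => Ψ (F (γ z)) - Ψ (γ z) - (F (γ z) - γ z))
    exact h.trans_isLittleO (hlo.trans_isBigO hD)
  refine hequiv.isBigO_symm.trans ?_
  have hGq : (fun z => (G (Ψ (γ z))).1 - (Ψ (γ z)).1) =O[𝓝 0] fun z => ‖Ψ (γ z)‖ ^ t :=
    hG.comp_tendsto (hΨt.comp hγt)
  have hqO : (fun z => Ψ (γ z)) =O[𝓝 0] fun z => z := (hΨO.comp_tendsto hγt).trans hγO
  refine (hGq.trans (hqO.norm_left.pow t)).congr' ?_ EventuallyEq.rfl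
  filter_upwards [hγt.eventually hconj] with z hz
  rw [hz]

/-- **Quasi-parabolic germs: `ν(F) = ∞` iff a curve of fixed points exists
(Proposition 6.2).**
Let `F(z,w) = (z + O(2), e^{2πiθ}w + O(2))`, `θ ∈ ℝ∖ℚ`, be a quasi-parabolic germ of
holomorphic diffeomorphism of `ℂ²` at `0`.  By Poincaré–Dulac theory `F` is formally
conjugated to `F̂(z,w) = (z + Σ_{j≥ν} a_j z^j, e^{2πiθ} w + Σ_{j≥μ} b_j z^j w)`;
formal conjugation is formalized order by order: for every `t` there is a change of
coordinates `Ψ(p) = p + O(|p|²)` conjugating `F` to a germ agreeing with `F̂` up to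
`O(|p|^t)`.  Then `ν(F) = +∞` (i.e. `a_j = 0` for all `j`) if and only if there exists a
germ of a holomorphic curve through `0` consisting of fixed points of `F`. -/
theorem quasi_parabolic_nu_infinite_iff_fixed_curve
    (θ : ℝ) (hθ : Irrational θ)
    (F : ℂ × ℂ → ℂ × ℂ)
    (hF : AnalyticAt ℂ F 0) (hF0 : F 0 = 0)
    (hqp : (fun p : ℂ × ℂ =>
        F p - (p.1, Complex.exp (2 * Real.pi * Complex.I * θ) * p.2))
      =O[nhds 0] fun p : ℂ × ℂ => ‖p‖ ^ 2)
    -- the coefficients of the Poincaré–Dulac formal normal form of `F`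
    (a b : ℕ → ℂ) (ha0 : a 0 = 0) (ha1 : a 1 = 0) (hb0 : b 0 = 0)
    (hconj : ∀ t : ℕ, ∃ Ψ G : ℂ × ℂ → ℂ × ℂ,
      AnalyticAt ℂ Ψ 0 ∧ Ψ 0 = 0 ∧
      ((fun p : ℂ × ℂ => Ψ p - p) =O[nhds 0] fun p : ℂ × ℂ => ‖p‖ ^ 2) ∧
      AnalyticAt ℂ G 0 ∧ (∀ᶠ p in nhds (0 : ℂ × ℂ), Ψ (F p) = G (Ψ p)) ∧
      ((fun p : ℂ × ℂ => G p -
          (p.1 + ∑ j ∈ Finset.range t, a j * p.1 ^ j,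
           Complex.exp (2 * Real.pi * Complex.I * θ) * p.2
             + (∑ j ∈ Finset.range t, b j * p.1 ^ j) * p.2))
        =O[nhds 0] fun p : ℂ × ℂ => ‖p‖ ^ t)) :
    (∀ j, a j = 0)
    ↔ (∃ γ : ℂ → ℂ × ℂ,
        AnalyticAt ℂ γ 0 ∧ γ 0 = 0 ∧
        ¬ (∀ᶠ ζ in nhds (0 : ℂ), γ ζ = 0) ∧
        ∀ᶠ ζ in nhds (0 : ℂ), F (γ ζ) = γ ζ) := by
  have hl := exp_two_pi_I_mul_ne_one hθ
  generalize Complex.exp (2 * Real.pi * Complex.I * θ) = l at *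
  constructor
  · intro ha
    obtain ⟨γ, hγ, hγ0, hfst, hsnd⟩ := exists_analyticAt_graph_snd_fixed hl hF hF0 hqp
    have hFγ : AnalyticAt ℂ (fun z => F (γ z)) 0 := AnalyticAt.comp (by rwa [hγ0]) hγ
    have hzero : ∀ᶠ z in nhds 0, (F (γ z)).1 - (γ z).1 = 0 := by
      refine AnalyticAt.eventually_eq_zero_of_isBigO_pow
        ((analyticAt_fst.comp hFγ).sub (analyticAt_fst.comp hγ)) fun t => ?_
      obtain ⟨Ψ, G, hΨ, hΨ0, hΨid, -, hconj', hG⟩ := hconj t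
      refine fst_sub_isBigO_pow_of_conj hF.continuousAt hF0 hΨ hΨ0 hΨid hconj' ?_ hγ hγ0 hsnd
      simpa [ha] using isBigO_fst_prod'.trans hG
    refine ⟨γ, hγ, hγ0, fun h => ?_, ?_⟩
    · have hz : ∀ᶠ z : ℂ in 𝓝[≠] 0, False := by
        filter_upwards [h.filter_mono nhdsWithin_le_nhds, hfst.filter_mono nhdsWithin_le_nhds,
          self_mem_nhdsWithin] with z h1 h2 h3
        exact h3 (by rw [← h2, h1]; rfl)
      exact hz.exists.choose_spec
    · filter_upwards [hzero, hsnd] with z h1 h2 using Prod.ext (sub_eq_zero.mp h1) h2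
  · rintro ⟨γ, hγ, hγ0, hne, hfix⟩ j
    have hγt : Tendsto γ (𝓝 0) (𝓝 0) := by simpa [hγ0] using hγ.continuousAt.tendsto
    let f : Filter ℂ := 𝓝 0 ⊓ Filter.principal {z | γ z ≠ 0}
    have : f.NeBot := Filter.frequently_mem_iff_neBot.mp (not_eventually.mp hne)
    have hγf : Tendsto γ f (𝓝 0) := hγt.mono_left inf_le_left
    induction j using Nat.strong_induction_on with
    | _ n ih =>
      rcases Nat.eq_zero_or_pos n with rfl | hn
      · exact ha0
      obtain ⟨Ψ, G, hΨ, hΨ0, hΨid, -, hconj', hG⟩ := hconj (n + 1)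
      have hΨt : Tendsto Ψ (𝓝 0) (𝓝 0) := by simpa [hΨ0] using hΨ.continuousAt.tendsto
      have hlo : (fun p : ℂ × ℂ => Ψ p - p) =o[𝓝 0] fun p => p := by
        have hΨd : HasFDerivAt Ψ (ContinuousLinearMap.id ℂ (ℂ × ℂ)) 0 :=
          hasFDerivAt_zero_of_sub_isBigO_sq hΨid
        simpa [hΨ0] using hΨd.isLittleO
      refine coeff_eq_zero_of_fixed_points hl hb0 hn ih hG (f := f) (q := fun z => Ψ (γ z))
        (tendsto_nhdsWithin_iff.mpr ⟨hΨt.comp hγf, ?_⟩) ?_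
      · filter_upwards [hγf.eventually (hlo.bound (show (0 : ℝ) < 1 / 2 by norm_num)),
          mem_inf_of_right (mem_principal_self _)] with z hz hz0 h0
        have hpos : 0 < ‖γ z‖ := norm_pos_iff.mpr hz0
        have h0' : Ψ (γ z) = 0 := h0
        rw [h0', zero_sub, norm_neg] at hz
        linarith
      · filter_upwards [hγf.eventually hconj', hfix.filter_mono inf_le_left] with z hz hz'
        rw [← hz, hz']
end

section
/- Let F be a dynamically separating quasi-parabolic germ of holomorphic diffeomorphism of ℂ² at 0, formally conjugated to F̂(z,w) = (z + Σ_{j≥ν} a_j z^j, e^{2πiθ} w + Σ_{j≥μ} b_j z^j w) with θ ∈ ℝ∖ℚ, a_ν ≠ 0, ν < ∞ and ν ≤ μ + 1. If Re(b_{ν−1} / (e^{2πiθ} a_ν)) > 0, then there exist ν(F) − 1 pairwise disjoint connected basins of attraction for F at 0. -/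
open Filter

/-- `U` is a basin of attraction at `0` for the self-map `F` of `ℂ²`. -/
def IsBasinAt2 (F : ℂ × ℂ → ℂ × ℂ) (U : Set (ℂ × ℂ)) : Prop :=
  U.Nonempty ∧ IsOpen U ∧ (0 : ℂ × ℂ) ∈ frontier U ∧
    ∃ Ω : ℕ → Set (ℂ × ℂ),
      (nhds (0 : ℂ × ℂ)).HasBasis (fun _ : ℕ => True) Ω ∧
        ∀ i, F '' (U ∩ Ω i) ⊆ U ∩ Ω i ∧
          ∀ p ∈ U ∩ Ω i, Tendsto (fun m => F^[m] p) atTop (nhds 0)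

/-- A forward invariant open set carrying a height that grows by a definite amount under `F`, and
whose superlevel sets shrink to `0`, is a basin of attraction. -/
theorem isBasinAt2_of_height {F : ℂ × ℂ → ℂ × ℂ} {U : Set (ℂ × ℂ)} (h : ℂ × ℂ → ℝ)
    (hne : U.Nonempty) (hU : IsOpen U) (h0 : (0 : ℂ × ℂ) ∉ U)
    (hstep : ∀ p ∈ U, F p ∈ U ∧ h p + 1 / 2 ≤ h (F p))
    (hlarge : ∀ ρ : ℝ, ∀ᶠ p in nhds (0 : ℂ × ℂ), p ∈ U → ρ < h p)
    (hsmall : ∀ N ∈ nhds (0 : ℂ × ℂ), ∃ ρ : ℝ, ∀ p ∈ U, ρ < h p → p ∈ N) :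
    IsBasinAt2 F U := by
  have hiter : ∀ p ∈ U, ∀ m : ℕ, F^[m] p ∈ U ∧ h p + m / 2 ≤ h (F^[m] p) := by
    intro p hp m
    induction m with
    | zero => simpa using hp
    | succ m ih =>
      rw [Function.iterate_succ_apply']
      have := hstep _ ih.1
      refine ⟨this.1, ?_⟩
      push_cast
      linarith [this.2, ih.2]
  have hlim : ∀ p ∈ U, Tendsto (fun m => F^[m] p) atTop (nhds 0) := by
    intro p hp
    rw [tendsto_def]
    intro N hN
    obtain ⟨ρ, hρ⟩ := hsmall N hN
    obtain ⟨M, hM⟩ := exists_nat_gt (2 * (ρ - h p))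
    filter_upwards [eventually_ge_atTop M] with m hm
    have := hiter p hp m
    have hmM : (M : ℝ) ≤ m := by exact_mod_cast hm
    exact hρ _ this.1 (by linarith [this.2])
  refine ⟨hne, hU, ?_, fun i => {p | p ∈ U ∧ (i : ℝ) < h p} ∪ (Metric.ball 0 (1 / ((i : ℝ) + 1)) \ U),
    ?_, ?_⟩
  · rw [hU.frontier_eq]
    obtain ⟨p, hp⟩ := hne
    exact ⟨mem_closure_of_tendsto (hlim p hp) (Eventually.of_forall fun m => (hiter p hp m).1), h0⟩
  · refine ⟨fun N => ⟨fun hN => ?_, ?_⟩⟩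
    · obtain ⟨ρ, hρ⟩ := hsmall N hN
      obtain ⟨δ, hδ, hball⟩ := Metric.mem_nhds_iff.1 hN
      obtain ⟨i, hi⟩ := exists_nat_gt (max ρ (1 / δ))
      have hi1 := (le_max_left _ _).trans_lt hi
      have hi2 := (le_max_right _ _).trans_lt hi
      refine ⟨i, trivial, ?_⟩
      rintro p (⟨hp, hpi⟩ | ⟨hp, -⟩)
      · exact hρ p hp (hi1.trans hpi)
      · refine hball (Metric.ball_subset_ball ?_ hp)
        rw [div_lt_iff₀ hδ] at hi2
        rw [div_le_iff₀ (by positivity)]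
        nlinarith
    · rintro ⟨i, -, hi⟩
      refine mem_of_superset ?_ hi
      filter_upwards [hlarge i, Metric.ball_mem_nhds (0 : ℂ × ℂ)
        (by positivity : (0 : ℝ) < 1 / ((i : ℝ) + 1))] with p hp hp'
      by_cases hpU : p ∈ U
      · exact Or.inl ⟨hpU, hp hpU⟩
      · exact Or.inr ⟨hp', hpU⟩
  · refine fun i => ⟨?_, fun p hp => hlim p hp.1⟩
    rintro _ ⟨p, ⟨hp, hpi⟩, rfl⟩
    have hpi' : (i : ℝ) < h p := by
      rcases hpi with hpi | hpi
      · exact hpi.2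
      · exact absurd hp hpi.2
    have := hstep p hp
    exact ⟨this.1, Or.inl ⟨this.1, by linarith [this.2]⟩⟩

/-- The open convex cone in the right half-plane with vertex `R` and slope `κ`. -/
def truncatedCone (κ R : ℝ) : Set ℂ := {u | |u.im| < κ * (u.re - R)}

/-- The set of `v` in the principal sector of opening `2π/r` for which `v⁻ʳ` lies in the
truncated cone. -/
def principalPetal (r : ℕ) (κ R : ℝ) : Set ℂ :=
  {v | v ∈ Complex.slitPlane ∧ |v.arg| < Real.pi / r ∧ (v ^ r)⁻¹ ∈ truncatedCone κ R}

/-- The fibred petal over the rotated principal petal `ζ · V`, with fibres `‖w‖ < ‖z‖ ^ β`. -/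
def fibredPetal (r : ℕ) (κ R β : ℝ) (ζ : ℂ) : Set (ℂ × ℂ) :=
  {p | p.1 / ζ ∈ principalPetal r κ R ∧ ‖p.2‖ < ‖p.1‖ ^ β}

/-- The real part of the Fatou coordinate `D / zʳ`. -/
noncomputable def fatouHeight (r : ℕ) (D : ℂ) (p : ℂ × ℂ) : ℝ := ((p.1 ^ r / D)⁻¹).re

theorem isOpen_truncatedCone (κ R : ℝ) : IsOpen (truncatedCone κ R) :=
  isOpen_lt (by fun_prop) (by fun_prop)

theorem convex_truncatedCone (κ R : ℝ) : Convex ℝ (truncatedCone κ R) := by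
  have : truncatedCone κ R =
      {u : ℂ | u.im - κ * u.re < - (κ * R)} ∩ {u : ℂ | - u.im - κ * u.re < - (κ * R)} := by
    ext u
    simp only [truncatedCone, Set.mem_ofPred_eq, Set.mem_inter_iff, abs_lt]
    constructor
    · rintro ⟨h1, h2⟩; constructor <;> linarith
    · rintro ⟨h1, h2⟩; constructor <;> linarith
  rw [this]
  refine (convex_halfSpace_lt ⟨?_, ?_⟩ _).inter (convex_halfSpace_lt ⟨?_, ?_⟩ _) <;>
    intros <;> simp <;> ring

theorem lt_re_of_mem_truncatedCone {κ R : ℝ} (hκ : 0 < κ) {u : ℂ} (hu : u ∈ truncatedCone κ R) :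
    R < u.re := by
  have h : |u.im| < κ * (u.re - R) := hu
  have := (mul_pos_iff_of_pos_left hκ).1 ((abs_nonneg u.im).trans_lt h)
  linarith

theorem isOpen_principalPetal (r : ℕ) (κ R : ℝ) : IsOpen (principalPetal r κ R) := by
  have h1 : ContinuousOn (fun v : ℂ => |v.arg|) Complex.slitPlane := fun v hv =>
    (Complex.continuousAt_arg hv).abs.continuousWithinAt
  have h2 : ContinuousOn (fun v : ℂ => (v ^ r)⁻¹) Complex.slitPlane := fun v hv =>
    ((continuousAt_id.pow r).inv₀ (pow_ne_zero r (Complex.slitPlane_ne_zero hv))).continuousWithinAt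
  have h := ((h1.isOpen_inter_preimage Complex.isOpen_slitPlane (isOpen_Iio (a := Real.pi / r))).inter
    (h2.isOpen_inter_preimage Complex.isOpen_slitPlane (isOpen_truncatedCone κ R)))
  convert h using 1
  ext v
  simp only [principalPetal, Set.mem_ofPred_eq, Set.mem_inter_iff, Set.mem_preimage, Set.mem_Iio]
  tauto

theorem pow_injOn_principalPetal {r : ℕ} (hr : r ≠ 0) {κ R κ' R' : ℝ} {v v' : ℂ}
    (hv : v ∈ principalPetal r κ R) (hv' : v' ∈ principalPetal r κ' R') (h : v ^ r = v' ^ r) :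
    v = v' := by
  rw [← Complex.pow_cpow_nat_inv hr (abs_lt.1 hv.2.1).1 (abs_lt.1 hv.2.1).2.le, h,
    Complex.pow_cpow_nat_inv hr (abs_lt.1 hv'.2.1).1 (abs_lt.1 hv'.2.1).2.le]

theorem principalPetal_eq_image {r : ℕ} (hr : r ≠ 0) {κ R : ℝ} (hκ : 0 < κ) (hR : 0 < R) :
    principalPetal r κ R = (fun u : ℂ => (u⁻¹) ^ ((r : ℂ)⁻¹)) '' truncatedCone κ R := by
  ext v
  constructor
  · intro hv
    refine ⟨_, hv.2.2, ?_⟩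
    simp only [inv_inv]
    exact Complex.pow_cpow_nat_inv hr (abs_lt.1 hv.2.1).1 (abs_lt.1 hv.2.1).2.le
  · rintro ⟨u, hu, rfl⟩
    have hre : 0 < u.re := hR.trans (lt_re_of_mem_truncatedCone hκ hu)
    have hu0 : u ≠ 0 := fun h => by simp [h] at hre
    have hre' : 0 < (u⁻¹).re := by
      rw [Complex.inv_re]; exact div_pos hre (Complex.normSq_pos.2 hu0)
    have harg : |(u⁻¹).arg| < Real.pi / 2 := Complex.abs_arg_lt_pi_div_two_iff.2 (Or.inl hre')
    have hr1 : (1 : ℝ) ≤ r := by exact_mod_cast Nat.one_le_iff_ne_zero.2 hr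
    have hlog : (Complex.log u⁻¹ * (r : ℂ)⁻¹).im = (u⁻¹).arg / r := by
      rw [← Complex.ofReal_natCast, ← Complex.ofReal_inv, Complex.im_mul_ofReal, Complex.log_im]
      rfl
    have hlt : |(u⁻¹).arg / r| < Real.pi / r := by
      rw [abs_div, abs_of_pos (by linarith : (0 : ℝ) < r)]
      gcongr
      linarith [Real.pi_pos]
    have hpi : Real.pi / r ≤ Real.pi := div_le_self Real.pi_pos.le hr1
    have hvarg : ((u⁻¹) ^ ((r : ℂ)⁻¹)).arg = (u⁻¹).arg / r := by
      rw [Complex.cpow_def_of_ne_zero (inv_ne_zero hu0), Complex.arg_exp, hlog]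
      rw [toIocMod_eq_self]
      constructor
      · linarith [(abs_lt.1 hlt).1]
      · linarith [(abs_lt.1 hlt).2]
    refine ⟨?_, ?_, ?_⟩
    · rw [Complex.mem_slitPlane_iff_arg]
      refine ⟨?_, ?_⟩
      · rw [hvarg]; intro h; rw [h] at hlt; linarith [le_abs_self Real.pi]
      · simp [Complex.cpow_eq_zero_iff, hu0]
    · simp only [hvarg]; exact hlt
    · simp only [Complex.cpow_nat_inv_pow _ hr, inv_inv]; exact hu

theorem isConnected_principalPetal {r : ℕ} (hr : r ≠ 0) {κ R : ℝ} (hκ : 0 < κ) (hR : 0 < R) :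
    IsConnected (principalPetal r κ R) := by
  rw [principalPetal_eq_image hr hκ hR]
  refine ((convex_truncatedCone κ R).isConnected ⟨(R + 1 : ℝ), ?_⟩).image _ ?_
  · simp [truncatedCone, hκ]
  · intro u hu
    have hre : 0 < u.re := hR.trans (lt_re_of_mem_truncatedCone hκ hu)
    have hu0 : u ≠ 0 := fun h => by simp [h] at hre
    refine ((continuousAt_inv₀ hu0).cpow continuousAt_const ?_).continuousWithinAt
    · left
      rw [Complex.inv_re]; exact div_pos hre (Complex.normSq_pos.2 hu0)

theorem fibredPetal_fst_ne_zero {r : ℕ} {κ R β : ℝ} {ζ : ℂ} {p : ℂ × ℂ}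
    (hp : p ∈ fibredPetal r κ R β ζ) : p.1 ≠ 0 := fun h =>
  Complex.slitPlane_ne_zero hp.1.1 (by simp [h])

theorem isOpen_fibredPetal (r : ℕ) (κ R : ℝ) {β : ℝ} (hβ : 0 < β) (ζ : ℂ) :
    IsOpen (fibredPetal r κ R β ζ) :=
  ((isOpen_principalPetal r κ R).preimage (by fun_prop : Continuous fun p : ℂ × ℂ => p.1 / ζ)).inter
    (isOpen_lt (by fun_prop) (continuous_fst.norm.rpow_const fun _ => Or.inr hβ.le))

theorem isConnected_fibredPetal {r : ℕ} (hr : r ≠ 0) {κ R β : ℝ} (hκ : 0 < κ) (hR : 0 < R)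
    (hβ : 0 < β) {ζ : ℂ} (hζ : ζ ≠ 0) : IsConnected (fibredPetal r κ R β ζ) := by
  have h := (isConnected_principalPetal hr hκ hR).prod
    ((convex_ball (0 : ℂ) 1).isConnected ⟨0, by simp⟩)
  have hc : Continuous fun x : ℂ × ℂ => (ζ * x.1, ((‖ζ * x.1‖ ^ β : ℝ) : ℂ) * x.2) := by
    refine Continuous.prodMk (by fun_prop) (Continuous.mul ?_ continuous_snd)
    exact Complex.continuous_ofReal.comp
      ((continuous_const.mul continuous_fst).norm.rpow_const fun _ => Or.inr hβ.le)
  convert h.image _ hc.continuousOn using 1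
  ext ⟨z, w⟩
  simp only [fibredPetal, Set.mem_ofPred_eq, Set.mem_image, Set.mem_prod, Metric.mem_ball,
    dist_zero_right, Prod.mk.injEq, Prod.exists]
  constructor
  · rintro ⟨hz, hw⟩
    have hz0 : z ≠ 0 := fun h => Complex.slitPlane_ne_zero hz.1 (by simp [h])
    have hpos : 0 < ‖z‖ ^ β := Real.rpow_pos_of_pos (norm_pos_iff.2 hz0) _
    have hpos' : ((‖z‖ ^ β : ℝ) : ℂ) ≠ 0 := by exact_mod_cast hpos.ne'
    refine ⟨z / ζ, w / ((‖z‖ ^ β : ℝ) : ℂ), ⟨hz, ?_⟩, by field_simp, ?_⟩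
    · rw [norm_div, Complex.norm_real, Real.norm_of_nonneg hpos.le, div_lt_one hpos]; exact hw
    · rw [mul_div_cancel₀ z hζ]; field_simp
  · rintro ⟨v, x, ⟨hv, hx⟩, rfl, rfl⟩
    have hv0 : ζ * v ≠ 0 := mul_ne_zero hζ (Complex.slitPlane_ne_zero hv.1)
    have hpos : 0 < ‖ζ * v‖ ^ β := Real.rpow_pos_of_pos (norm_pos_iff.2 hv0) _
    refine ⟨by rwa [mul_div_cancel_left₀ v hζ], ?_⟩
    rw [norm_mul (((‖ζ * v‖ ^ β : ℝ) : ℂ)), Complex.norm_real, Real.norm_of_nonneg hpos.le]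
    nlinarith

theorem disjoint_fibredPetal {r : ℕ} (hr : r ≠ 0) {κ R β : ℝ} {ζ ζ' : ℂ}
    (hpow : ζ ^ r = ζ' ^ r) (hne : ζ ≠ ζ') :
    Disjoint (fibredPetal r κ R β ζ) (fibredPetal r κ R β ζ') := by
  rw [Set.disjoint_left]
  intro p hp hp'
  have h := pow_injOn_principalPetal hr hp.1 hp'.1 (by rw [div_pow, div_pow, hpow])
  have hp0 := fibredPetal_fst_ne_zero hp
  rw [div_eq_mul_inv, div_eq_mul_inv] at h
  exact hne (inv_injective (mul_left_cancel₀ hp0 h))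

theorem exists_fatouHeight_small {r : ℕ} (hr : r ≠ 0) {D : ℂ} (hD : D ≠ 0) {β : ℝ} (hβ : 0 < β)
    {N : Set (ℂ × ℂ)} (hN : N ∈ nhds (0 : ℂ × ℂ)) :
    ∃ ρ : ℝ, 0 < ρ ∧ ∀ p : ℂ × ℂ, ρ < fatouHeight r D p → ‖p.2‖ < ‖p.1‖ ^ β → p ∈ N := by
  obtain ⟨δ, hδ, hball⟩ := Metric.mem_nhds_iff.1 hN
  set m : ℝ := min δ (δ ^ β⁻¹) with hm
  have hm0 : 0 < m := lt_min hδ (Real.rpow_pos_of_pos hδ _)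
  have hDn : 0 < ‖D‖ := norm_pos_iff.2 hD
  refine ⟨‖D‖ / m ^ r, by positivity, fun p hp hw => hball ?_⟩
  have h1 : ‖D‖ / m ^ r < ‖D‖ / ‖p.1‖ ^ r := by
    refine hp.trans_le ((Complex.re_le_norm _).trans_eq ?_)
    rw [inv_div, norm_div, norm_pow]
  have hp0 : 0 < ‖p.1‖ := by
    rw [norm_pos_iff]; intro h
    rw [h, norm_zero, zero_pow hr, div_zero] at h1
    exact absurd h1 (not_lt.2 (by positivity))
  have h2 : ‖p.1‖ < m := by
    rw [div_lt_div_iff_of_pos_left hDn (by positivity) (by positivity)] at h1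
    exact lt_of_pow_lt_pow_left₀ r hm0.le h1
  rw [mem_ball_zero_iff, Prod.norm_def, max_lt_iff]
  refine ⟨h2.trans_le (min_le_left _ _), hw.trans ?_⟩
  calc ‖p.1‖ ^ β < (δ ^ β⁻¹) ^ β :=
        Real.rpow_lt_rpow hp0.le (h2.trans_le (min_le_right _ _)) hβ
    _ = δ := Real.rpow_inv_rpow hδ.le hβ.ne'

theorem eventually_lt_fatouHeight {r : ℕ} (hr : r ≠ 0) {D ζ : ℂ} (hζ : ζ ^ r = D) (hD : D ≠ 0)
    {κ R β : ℝ} (hκ : 0 < κ) (hκ1 : κ ≤ 1) (hR : 0 < R) (ρ : ℝ) :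
    ∀ᶠ p in nhds (0 : ℂ × ℂ), p ∈ fibredPetal r κ R β ζ → ρ < fatouHeight r D p := by
  have hDn : 0 < ‖D‖ := norm_pos_iff.2 hD
  have hc : Tendsto (fun p : ℂ × ℂ => 2 * (|ρ| + 1) * ‖p.1‖ ^ r) (nhds 0) (nhds 0) := by
    have : Continuous (fun p : ℂ × ℂ => 2 * (|ρ| + 1) * ‖p.1‖ ^ r) := by fun_prop
    simpa [hr] using this.tendsto 0
  filter_upwards [hc.eventually_lt_const hDn] with p hp hmem
  have hp0 : 0 < ‖p.1‖ := norm_pos_iff.2 (fibredPetal_fst_ne_zero hmem)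
  have hu := hmem.1.2.2
  rw [div_pow, hζ] at hu
  have hre := lt_re_of_mem_truncatedCone hκ hu
  have him : |((p.1 ^ r / D)⁻¹).im| < κ * (((p.1 ^ r / D)⁻¹).re - R) := hu
  have hn := Complex.norm_le_abs_re_add_abs_im (p.1 ^ r / D)⁻¹
  rw [abs_of_pos (hR.trans hre)] at hn
  have h3 : 2 * (|ρ| + 1) < ‖(p.1 ^ r / D)⁻¹‖ := by
    rw [inv_div, norm_div, norm_pow, lt_div_iff₀ (by positivity)]; exact hp
  unfold fatouHeight
  nlinarith [le_abs_self ρ]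

/-- Near `0`, the perturbed parabolic map `v ↦ v (1 - vʳ / r + e)` preserves the principal petal and
moves its Fatou coordinate to the right by at least `1 / 2`. -/
theorem exists_principalPetal_step {r : ℕ} (hr : r ≠ 0) {κ : ℝ} (hκ : 0 < κ) (hκ1 : κ ≤ 1) :
    ∃ ε > 0, ∃ δ > 0, ∀ R > 0, ∀ v ∈ principalPetal r κ R, ∀ e : ℂ,
      ‖v ^ r‖ < δ → ‖e‖ ≤ ε * ‖v ^ r‖ →
        v * (1 - v ^ r / r + e) ∈ principalPetal r κ R ∧
          ((v ^ r)⁻¹).re + 1 / 2 ≤ (((v * (1 - v ^ r / r + e)) ^ r)⁻¹).re := by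
  have hr1 : (1 : ℝ) ≤ r := by exact_mod_cast Nat.one_le_iff_ne_zero.2 hr
  have hr0 : (0 : ℝ) < r := by linarith
  have hpi := Real.pi_pos
  have hderiv : HasDerivAt (fun η : ℂ => ((1 + η) ^ r)⁻¹) (-(r : ℂ)) 0 := by
    have h := (((hasDerivAt_id' (0 : ℂ)).const_add 1).fun_pow r).fun_inv (by simp)
    exact h.congr_deriv (by simp)
  have hlin : ∀ᶠ η in nhds (0 : ℂ), ‖((1 + η) ^ r)⁻¹ - 1 + (r : ℂ) * η‖ ≤ κ / 16 * ‖η‖ := by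
    have h := hderiv.isLittleO.bound (by positivity : (0 : ℝ) < κ / 16)
    filter_upwards [h] with η hη
    simp only [add_zero, one_pow, inv_one, sub_zero, smul_eq_mul] at hη
    convert hη using 2
    congr 1
    ring
  have harg : ∀ᶠ η in nhds (0 : ℂ), |(1 + η).arg| < Real.pi / (2 * r) := by
    have hc : ContinuousAt (fun η : ℂ => |(1 + η).arg|) 0 := by
      refine ContinuousAt.abs (ContinuousAt.comp (g := Complex.arg) ?_ (by fun_prop))
      exact Complex.continuousAt_arg (by simp)
    have := hc.tendsto
    simp only [add_zero, Complex.arg_one, abs_zero] at this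
    exact this.eventually_lt_const (by positivity)
  obtain ⟨d, hd, hball⟩ := Metric.eventually_nhds_iff.1 (hlin.and harg)
  refine ⟨κ / (8 * r), by positivity, min (d / 2) (1 / 2), by positivity, ?_⟩
  intro R hR v hv e hq he
  set q := v ^ r with hqdef
  have hv0 : v ≠ 0 := Complex.slitPlane_ne_zero hv.1
  have hq0 : q ≠ 0 := pow_ne_zero r hv0
  have hqn : 0 < ‖q‖ := norm_pos_iff.2 hq0
  have hrc : (r : ℂ) ≠ 0 := by exact_mod_cast hr
  set η : ℂ := -(q / r) + e with hη
  have h1η : 1 - q / r + e = 1 + η := by rw [hη]; ring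
  rw [h1η]
  have hηn : ‖η‖ ≤ 2 * ‖q‖ := by
    have h1 : ‖q / r‖ ≤ ‖q‖ := by
      rw [norm_div, Complex.norm_natCast]; exact div_le_self hqn.le hr1
    have h2 : κ / (8 * r) ≤ 1 := by
      rw [div_le_one (by positivity)]; linarith
    have h3 : ‖e‖ ≤ ‖q‖ := he.trans (mul_le_of_le_one_left hqn.le h2)
    calc ‖η‖ ≤ ‖-(q / r)‖ + ‖e‖ := norm_add_le _ _
      _ ≤ 2 * ‖q‖ := by rw [norm_neg]; linarith
  have hηd : ‖η‖ < d := by linarith [hq.trans_le (min_le_left _ _)]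
  have hη1 : ‖η‖ < 1 := by linarith [hq.trans_le (min_le_right _ _)]
  obtain ⟨hlinη, hargη⟩ := hball (y := η) (by simpa using hηd)
  have hη0 : 1 + η ≠ 0 := by
    intro h
    have : η = -1 := by linear_combination h
    rw [this] at hη1
    simp at hη1
  have hu1 : ‖((v * (1 + η)) ^ r)⁻¹ - q⁻¹ - 1‖ ≤ κ / 4 := by
    have heq : ((v * (1 + η)) ^ r)⁻¹ - q⁻¹ - 1 =
        q⁻¹ * (((1 + η) ^ r)⁻¹ - 1 + r * η) - r * e * q⁻¹ := by
      rw [mul_pow, mul_inv, ← hqdef, hη]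
      field_simp
      ring
    have h1 : ‖q⁻¹ * (((1 + η) ^ r)⁻¹ - 1 + r * η)‖ ≤ κ / 8 := by
      rw [norm_mul, norm_inv, inv_mul_le_iff₀ hqn]
      calc _ ≤ _ := hlinη
        _ ≤ κ / 16 * (2 * ‖q‖) := by gcongr
        _ = ‖q‖ * (κ / 8) := by ring
    have h2 : ‖r * e * q⁻¹‖ ≤ κ / 8 := by
      rw [norm_mul, norm_inv, mul_inv_le_iff₀ hqn, norm_mul, Complex.norm_natCast]
      calc r * ‖e‖ ≤ r * (κ / (8 * r) * ‖q‖) := by gcongr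
        _ = κ / 8 * ‖q‖ := by field_simp
    rw [heq]
    linarith [norm_sub_le (q⁻¹ * (((1 + η) ^ r)⁻¹ - 1 + r * η)) (r * e * q⁻¹)]
  have hre := (Complex.abs_re_le_norm _).trans hu1
  have him := (Complex.abs_im_le_norm _).trans hu1
  simp only [Complex.sub_re, Complex.sub_im, Complex.one_re, Complex.one_im, sub_zero] at hre him
  have hcone : |(q⁻¹).im| < κ * ((q⁻¹).re - R) := hv.2.2
  have hreq : 0 < (q⁻¹).re := hR.trans (lt_re_of_mem_truncatedCone hκ hv.2.2)
  have hargv : |v.arg| < Real.pi / (2 * r) := by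
    by_contra! hcon
    have hqre : 0 < q.re := by
      have h : (q⁻¹).re = q.re / Complex.normSq q := Complex.inv_re q
      rw [h] at hreq
      exact (div_pos_iff_of_pos_right (Complex.normSq_pos.2 hq0)).1 hreq
    have hqre' : q.re = ‖v‖ ^ r * Real.cos (r * |v.arg|) := by
      have h : q = ((‖v‖ ^ r : ℝ) : ℂ) * Complex.exp (((r * v.arg : ℝ) : ℂ) * Complex.I) := by
        rw [hqdef]
        conv_lhs => rw [← Complex.norm_mul_exp_arg_mul_I v]
        rw [mul_pow, ← Complex.exp_nat_mul]
        push_cast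
        ring_nf
      rw [h, Complex.re_ofReal_mul, Complex.exp_ofReal_mul_I_re, ← Real.cos_abs, abs_mul,
        abs_of_pos hr0]
    have hcos : Real.cos (r * |v.arg|) ≤ 0 := by
      apply Real.cos_nonpos_of_pi_div_two_le_of_le
      · calc Real.pi / 2 = r * (Real.pi / (2 * r)) := by field_simp
          _ ≤ _ := by gcongr
      · have : r * |v.arg| ≤ r * (Real.pi / r) := by gcongr; exact hv.2.1.le
        rw [mul_div_cancel₀ _ hr0.ne'] at this
        linarith
    rw [hqre'] at hqre
    exact absurd hqre (not_lt.2 (mul_nonpos_of_nonneg_of_nonpos (by positivity) hcos))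
  have hsum : |v.arg + (1 + η).arg| < Real.pi / r := by
    calc _ ≤ |v.arg| + |(1 + η).arg| := abs_add_le _ _
      _ < Real.pi / (2 * r) + Real.pi / (2 * r) := add_lt_add hargv hargη
      _ = Real.pi / r := by field_simp; ring
  have hpir : Real.pi / r ≤ Real.pi := div_le_self hpi.le hr1
  have hsum' := abs_lt.1 (hsum.trans_le hpir)
  have hargmul : (v * (1 + η)).arg = v.arg + (1 + η).arg :=
    Complex.arg_mul hv0 hη0 ⟨hsum'.1, hsum'.2.le⟩
  refine ⟨⟨?_, ?_, ?_⟩, ?_⟩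
  · rw [Complex.mem_slitPlane_iff_arg, hargmul]
    exact ⟨hsum'.2.ne, mul_ne_zero hv0 hη0⟩
  · rw [hargmul]; exact hsum
  · change |_| < κ * (_ - R)
    have h1 := abs_sub_abs_le_abs_sub (((v * (1 + η)) ^ r)⁻¹).im (q⁻¹).im
    have h2 := abs_le.1 hre
    nlinarith [h2.1]
  · linarith [(abs_le.1 hre).1]

theorem norm_one_sub_le (y : ℂ) : ‖1 - y‖ ≤ 1 - y.re + ‖y‖ ^ 2 / 2 := by
  have h : ‖1 - y‖ ^ 2 = 1 - 2 * y.re + ‖y‖ ^ 2 := by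
    rw [← Complex.normSq_eq_norm_sq, ← Complex.normSq_eq_norm_sq, Complex.normSq_apply,
      Complex.normSq_apply]
    simp
    ring
  have h2 : y.re ^ 2 ≤ ‖y‖ ^ 2 := by
    rw [← sq_abs y.re]; gcongr; exact Complex.abs_re_le_norm y
  by_contra! hcon
  nlinarith [norm_nonneg (1 - y), sq_nonneg (‖y‖ ^ 2 / 2 - y.re),
    sq_nonneg (y.re - 1)]

theorem exp_neg_two_mul_le {y : ℝ} (h0 : 0 ≤ y) (h1 : y ≤ 1 / 2) : Real.exp (-(2 * y)) ≤ 1 - y := by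
  rw [Real.exp_neg, inv_le_iff_one_le_mul₀ (Real.exp_pos _)]
  nlinarith [Real.add_one_le_exp (2 * y)]

/-- The multiplier in the fibre direction is dominated by the `β`-th power of the multiplier of the
base, for `β` small enough. -/
theorem exists_fibre_step {r : ℕ} (hr : r ≠ 0) {c : ℂ} (hc : 0 < c.re) {β κ : ℝ} (hβ : 0 < β)
    (hβc : β ≤ c.re / (32 * r)) (hκ1 : κ ≤ 1 / 4) (hκc : κ * ‖c‖ ≤ c.re / 4) :
    ∃ ε > 0, ∃ δ > 0, ∀ q e : ℂ, q ≠ 0 → ‖q‖ < δ → |q.im| ≤ κ * q.re → 0 ≤ q.re →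
      ‖e‖ ≤ ε * ‖q‖ → ‖1 - c / r * q‖ + ε * ‖q‖ < ‖1 - q / r + e‖ ^ β := by
  have hr1 : (1 : ℝ) ≤ r := by exact_mod_cast Nat.one_le_iff_ne_zero.2 hr
  have hr0 : (0 : ℝ) < r := by linarith
  have hcn : 0 < ‖c‖ := norm_pos_iff.2 fun h => by simp [h] at hc
  set g : ℝ := c.re / (8 * r) with hg
  have hg0 : 0 < g := by positivity
  have hβg : β ≤ g / 4 := hβc.trans_eq (by rw [hg]; field_simp; norm_num)
  refine ⟨min 1 g, by positivity, min (1 / 4) (min (1 / ‖c‖) (2 * g / ‖c‖ ^ 2)), by positivity, ?_⟩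
  intro q e hq0 hq him hre he
  have hqn : 0 < ‖q‖ := norm_pos_iff.2 hq0
  obtain ⟨hq1, hq2⟩ := lt_min_iff.1 hq
  obtain ⟨hq2, hq3⟩ := lt_min_iff.1 hq2
  rw [lt_div_iff₀ hcn] at hq2
  rw [lt_div_iff₀ (by positivity)] at hq3
  have hlow : 4 * g * ‖q‖ ≤ (c / r * q).re := by
    have h1 : (c / r * q).re = (c.re * q.re - c.im * q.im) / r := by
      rw [div_mul_eq_mul_div, Complex.div_natCast_re, Complex.mul_re]
    have h2 : c.im * q.im ≤ ‖c‖ * (κ * q.re) := by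
      calc c.im * q.im ≤ |c.im| * |q.im| := by rw [← abs_mul]; exact le_abs_self _
        _ ≤ _ := by gcongr; exact Complex.abs_im_le_norm c
    have h3 : ‖q‖ ≤ 5 / 4 * q.re := by
      have := Complex.norm_le_abs_re_add_abs_im q
      rw [abs_of_nonneg hre] at this
      nlinarith
    rw [h1, hg, le_div_iff₀ hr0]
    have h4 : 4 * (c.re / (8 * r)) * ‖q‖ * r = c.re / 2 * ‖q‖ := by field_simp; norm_num
    rw [h4]
    nlinarith
  have hyn : ‖c / r * q‖ ≤ ‖c‖ * ‖q‖ := by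
    rw [norm_mul, norm_div, Complex.norm_natCast]
    gcongr
    exact div_le_self hcn.le hr1
  have hup : ‖1 - c / r * q‖ ≤ 1 - 3 * g * ‖q‖ := by
    refine (norm_one_sub_le _).trans ?_
    have : ‖c / r * q‖ ^ 2 ≤ (‖c‖ * ‖q‖) ^ 2 := by gcongr
    nlinarith
  have hz : Real.exp (-(4 * ‖q‖)) ≤ ‖1 - q / r + e‖ := by
    have h1 : ‖q / r‖ ≤ ‖q‖ := by
      rw [norm_div, Complex.norm_natCast]; exact div_le_self hqn.le hr1
    have h2 : ‖e‖ ≤ ‖q‖ := he.trans (mul_le_of_le_one_left hqn.le (min_le_left _ _))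
    have h3 : 1 - 2 * ‖q‖ ≤ ‖1 - q / r + e‖ := by
      have h4 : ‖(1 : ℂ)‖ ≤ ‖1 - q / r + e‖ + ‖q / r - e‖ := by
        refine (norm_add_le _ _).trans' (le_of_eq ?_)
        congr 1; ring
      rw [norm_one] at h4
      linarith [norm_sub_le (q / r) e]
    refine le_trans ?_ h3
    have := exp_neg_two_mul_le (y := 2 * ‖q‖) (by positivity) (by linarith)
    rwa [← mul_assoc, (by norm_num : (2 : ℝ) * 2 = 4)] at this
  calc ‖1 - c / r * q‖ + min 1 g * ‖q‖ ≤ (1 - 3 * g * ‖q‖) + g * ‖q‖ := by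
        gcongr; exact min_le_right _ _
    _ ≤ Real.exp (-(2 * g * ‖q‖)) := by linarith [Real.add_one_le_exp (-(2 * g * ‖q‖))]
    _ < Real.exp (-(4 * ‖q‖) * β) := by
        rw [Real.exp_lt_exp]
        nlinarith [mul_pos hg0 hqn, mul_le_mul_of_nonneg_left hβg hqn.le]
    _ = Real.exp (-(4 * ‖q‖)) ^ β := Real.exp_mul _ _
    _ ≤ _ := by gcongr

/-- A germ with normal form `(z + A zʳ⁺¹ + …, l w + b zʳ w + …)` which is parabolically
attracting leaves arbitrarily small fibred petals invariant. -/
theorem exists_invariant_fibredPetals {r : ℕ} (hr : r ≠ 0) {A b l : ℂ} (hA : A ≠ 0) (hl : ‖l‖ = 1)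
    (hre : 0 < (b / (l * A)).re) :
    ∃ β κ : ℝ, 0 < β ∧ 0 < κ ∧ κ ≤ 1 ∧ ∀ (t : ℕ) (G : ℂ × ℂ → ℂ × ℂ) (C : ℝ),
      r + 2 ≤ β * t → 0 ≤ C →
      (∀ᶠ p in nhds (0 : ℂ × ℂ),
        ‖(G p).1 - (p.1 + A * p.1 ^ (r + 1))‖ ≤ C * (‖p.1‖ ^ (r + 2) + ‖p‖ ^ t) ∧
        ‖(G p).2 - (l * p.2 + b * p.1 ^ r * p.2)‖ ≤
          C * (‖p.1‖ ^ (r + 1) * ‖p.2‖ + ‖p‖ ^ t)) →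
      ∀ N ∈ nhds (0 : ℂ × ℂ), ∃ R > 0, ∀ ζ : ℂ, ζ ^ r = -(1 / (r * A)) →
        fibredPetal r κ R β ζ ⊆ N ∧ ∀ p ∈ fibredPetal r κ R β ζ,
          G p ∈ fibredPetal r κ R β ζ ∧
          fatouHeight r (-(1 / (r * A))) p + 1 / 2 ≤ fatouHeight r (-(1 / (r * A))) (G p) := by
  have hr1 : (1 : ℝ) ≤ r := by exact_mod_cast Nat.one_le_iff_ne_zero.2 hr
  have hr0 : (0 : ℝ) < r := by linarith
  have hrc : (r : ℂ) ≠ 0 := by exact_mod_cast hr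
  set c := b / (l * A) with hc
  have hcn : 0 < ‖c‖ := norm_pos_iff.2 fun h => by simp [h] at hre
  have hAn : 0 < ‖A‖ := norm_pos_iff.2 hA
  have hl0 : l ≠ 0 := norm_pos_iff.1 (by rw [hl]; exact one_pos)
  set β := min 1 (c.re / (32 * r)) with hβ
  set κ := min (1 / 4) (c.re / (4 * ‖c‖)) with hκ
  have hβ0 : 0 < β := by positivity
  have hβ1 : β ≤ 1 := min_le_left _ _
  have hκ0 : 0 < κ := by positivity
  have hκ1 : κ ≤ 1 / 4 := min_le_left _ _
  have hκc : κ * ‖c‖ ≤ c.re / 4 := by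
    calc κ * ‖c‖ ≤ c.re / (4 * ‖c‖) * ‖c‖ := by gcongr; exact min_le_right _ _
      _ = c.re / 4 := by field_simp
  refine ⟨β, κ, hβ0, hκ0, by linarith, ?_⟩
  intro t G C ht hC hG N hN
  obtain ⟨ε₁, hε₁, δ₁, hδ₁, hstep₁⟩ := exists_principalPetal_step hr hκ0 (by linarith)
  obtain ⟨ε₂, hε₂, δ₂, hδ₂, hstep₂⟩ := exists_fibre_step hr hre hβ0 (min_le_right _ _) hκ1 hκc
  set D : ℂ := -(1 / (r * A)) with hD
  have hD0 : D ≠ 0 := neg_ne_zero.2 (one_div_ne_zero (mul_ne_zero hrc hA))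
  set ε := min ε₁ ε₂
  have hε : 0 < ε := lt_min hε₁ hε₂
  have hsmall : ∀ᶠ p in nhds (0 : ℂ × ℂ), ‖p.1‖ < 1 ∧ 2 * C * ‖p.1‖ < ε * (r * ‖A‖) ∧
      r * ‖A‖ * ‖p.1‖ ^ r < min δ₁ δ₂ := by
    have h1 : Continuous fun p : ℂ × ℂ => ‖p.1‖ := by fun_prop
    have h2 : Continuous fun p : ℂ × ℂ => 2 * C * ‖p.1‖ := by fun_prop
    have h3 : Continuous fun p : ℂ × ℂ => r * ‖A‖ * ‖p.1‖ ^ r := by fun_prop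
    refine ((h1.tendsto 0).eventually_lt_const (by simp)).and
      (((h2.tendsto 0).eventually_lt_const ?_).and ((h3.tendsto 0).eventually_lt_const ?_))
    · simp only [Prod.fst_zero, norm_zero, mul_zero]; positivity
    · simp only [Prod.fst_zero, norm_zero, zero_pow hr, mul_zero]; exact lt_min hδ₁ hδ₂
  obtain ⟨R, hR, hRN⟩ := exists_fatouHeight_small hr hD0 hβ0
    (inter_mem hN (hG.and hsmall))
  refine ⟨R, hR, fun ζ hζ => ?_⟩
  have hζ0 : ζ ≠ 0 := fun h => hD0 (by rw [← hζ, h, zero_pow hr])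
  have hmem : ∀ p ∈ fibredPetal r κ R β ζ, p ∈ N ∩ {p | _} := fun p hp => by
    refine hRN p ?_ hp.2
    have := lt_re_of_mem_truncatedCone hκ0 hp.1.2.2
    rwa [div_pow, hζ] at this
  refine ⟨fun p hp => (hmem p hp).1, ?_⟩
  rintro ⟨z, w⟩ hp
  have hz0 : z ≠ 0 := fibredPetal_fst_ne_zero hp
  obtain ⟨-, ⟨hG1, hG2⟩, hz1, hz2, hz3⟩ := hmem _ hp
  obtain ⟨hv, hw⟩ := hp
  simp only at hv hw hG1 hG2 hz1 hz2 hz3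
  set v := z / ζ with hvdef
  have hq : v ^ r = z ^ r / D := by rw [hvdef, div_pow, hζ]
  have hq' : v ^ r = -(r * A * z ^ r) := by rw [hq, hD]; field_simp
  have hqn : ‖v ^ r‖ = r * ‖A‖ * ‖z‖ ^ r := by
    rw [hq', norm_neg, norm_mul, norm_mul, norm_pow, Complex.norm_natCast]
  have hzn : 0 < ‖z‖ := norm_pos_iff.2 hz0
  have hzr : ‖z‖ ^ (r + 2) ≤ ‖z‖ ^ (r + 1) * ‖z‖ ^ β := by
    rw [pow_succ _ (r + 1)]
    gcongr
    simpa using Real.rpow_le_rpow_of_exponent_ge hzn hz1.le hβ1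
  have hpn : ‖((z, w) : ℂ × ℂ)‖ ^ t ≤ ‖z‖ ^ (r + 2) := by
    have h1 : ‖((z, w) : ℂ × ℂ)‖ ≤ ‖z‖ ^ β := by
      rw [Prod.norm_def]
      refine max_le ?_ hw.le
      simpa using Real.rpow_le_rpow_of_exponent_ge hzn hz1.le hβ1
    calc ‖((z, w) : ℂ × ℂ)‖ ^ t ≤ (‖z‖ ^ β) ^ t := by gcongr
      _ = ‖z‖ ^ (β * t) := by rw [Real.rpow_mul hzn.le, Real.rpow_natCast]
      _ ≤ ‖z‖ ^ ((r + 2 : ℕ) : ℝ) :=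
          Real.rpow_le_rpow_of_exponent_ge hzn hz1.le (by push_cast; exact ht)
      _ = ‖z‖ ^ (r + 2) := Real.rpow_natCast _ _
  have herr : 2 * C * ‖z‖ ^ (r + 1) ≤ ε * ‖v ^ r‖ := by
    rw [hqn, pow_succ]
    calc 2 * C * (‖z‖ ^ r * ‖z‖) = (2 * C * ‖z‖) * ‖z‖ ^ r := by ring
      _ ≤ (ε * (r * ‖A‖)) * ‖z‖ ^ r := by gcongr
      _ = _ := by ring
  set e := ((G (z, w)).1 - (z + A * z ^ (r + 1))) / z with he
  have hen : ‖e‖ ≤ ε * ‖v ^ r‖ := by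
    refine le_trans ?_ herr
    rw [he, norm_div, div_le_iff₀ hzn]
    calc _ ≤ C * (‖z‖ ^ (r + 2) + ‖(z, w)‖ ^ t) := hG1
      _ ≤ C * (‖z‖ ^ (r + 2) + ‖z‖ ^ (r + 2)) := by gcongr
      _ = _ := by ring
  have hGz : (G (z, w)).1 = z * (1 - v ^ r / r + e) := by
    rw [hq', he]; field_simp; ring
  have hGv : (G (z, w)).1 / ζ = v * (1 - v ^ r / r + e) := by
    rw [hGz, hvdef]; ring
  have hvn0 : v ^ r ≠ 0 := pow_ne_zero r (Complex.slitPlane_ne_zero hv.1)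
  have hcone : |((v ^ r)⁻¹).im| < κ * (((v ^ r)⁻¹).re - R) := hv.2.2
  have hureR := lt_re_of_mem_truncatedCone hκ0 hv.2.2
  have hqre : 0 ≤ (v ^ r).re ∧ |(v ^ r).im| ≤ κ * (v ^ r).re := by
    have hpos := Complex.normSq_pos.2 hvn0
    rw [Complex.inv_re, Complex.inv_im, abs_div, abs_neg, abs_of_pos hpos] at hcone
    rw [Complex.inv_re] at hureR
    have h1 : 0 < (v ^ r).re := (div_pos_iff_of_pos_right hpos).1 (hR.trans hureR)
    refine ⟨h1.le, ?_⟩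
    have h2 : |(v ^ r).im| / Complex.normSq (v ^ r) ≤
        (κ * (v ^ r).re) / Complex.normSq (v ^ r) := by
      rw [mul_div_assoc]; nlinarith
    exact (div_le_div_iff_of_pos_right hpos).1 h2
  rw [← hqn] at hz3
  obtain ⟨hpetal, hheight⟩ := hstep₁ R hR v hv e (hz3.trans_le (min_le_left _ _))
    (hen.trans (by gcongr; exact min_le_left _ _))
  have hfib := hstep₂ (v ^ r) e hvn0 (hz3.trans_le (min_le_right _ _)) hqre.2 hqre.1
    (hen.trans (by gcongr; exact min_le_right _ _))
  refine ⟨⟨by rw [hGv]; exact hpetal, ?_⟩, ?_⟩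
  · have hw1 : ‖(G (z, w)).2‖ ≤ ‖z‖ ^ β * (‖1 - c / r * v ^ r‖ + ε₂ * ‖v ^ r‖) := by
      have h1 : ‖l * w + b * z ^ r * w‖ ≤ ‖z‖ ^ β * ‖1 - c / r * v ^ r‖ := by
        have : l * w + b * z ^ r * w = l * w * (1 - c / r * v ^ r) := by
          rw [hq', hc]; field_simp; ring
        rw [this, norm_mul, norm_mul, hl, one_mul]
        gcongr
      have h2 : ‖(G (z, w)).2 - (l * w + b * z ^ r * w)‖ ≤ ‖z‖ ^ β * (ε₂ * ‖v ^ r‖) := by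
        calc _ ≤ C * (‖z‖ ^ (r + 1) * ‖w‖ + ‖(z, w)‖ ^ t) := hG2
          _ ≤ C * (‖z‖ ^ (r + 1) * ‖z‖ ^ β + ‖z‖ ^ (r + 1) * ‖z‖ ^ β) := by
              gcongr
              exact hpn.trans hzr
          _ = ‖z‖ ^ β * (2 * C * ‖z‖ ^ (r + 1)) := by ring
          _ ≤ ‖z‖ ^ β * (ε₂ * ‖v ^ r‖) :=
              mul_le_mul_of_nonneg_left (herr.trans (by gcongr; exact min_le_right _ _))
                (by positivity)
      have h3 := norm_add_le (l * w + b * z ^ r * w) ((G (z, w)).2 - (l * w + b * z ^ r * w))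
      rw [add_sub_cancel] at h3
      linarith
    refine hw1.trans_lt ?_
    rw [hGz, norm_mul, Real.mul_rpow hzn.le (norm_nonneg _)]
    gcongr
  · have h1 : fatouHeight r D (z, w) = ((v ^ r)⁻¹).re := by rw [hq]; rfl
    have h2 : fatouHeight r D (G (z, w)) = (((v * (1 - v ^ r / r + e)) ^ r)⁻¹).re := by
      rw [← hGv, div_pow, hζ]; rfl
    rw [h1, h2]
    exact hheight

theorem norm_sum_range_sub_le (a : ℕ → ℂ) {m t : ℕ} (hm : m < t) (hlow : ∀ j < m, a j = 0)
    {z : ℂ} (hz : ‖z‖ ≤ 1) :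
    ‖∑ j ∈ Finset.range t, a j * z ^ j - a m * z ^ m‖ ≤
      (∑ j ∈ Finset.range t, ‖a j‖) * ‖z‖ ^ (m + 1) := by
  rw [← Finset.sum_erase_eq_sub (Finset.mem_range.2 hm), Finset.sum_mul]
  refine (norm_sum_le _ _).trans ((Finset.sum_le_sum fun j hj => ?_).trans
    (Finset.sum_le_sum_of_subset_of_nonneg (Finset.erase_subset m _) fun _ _ _ => by positivity))
  rw [norm_mul, norm_pow]
  rcases lt_or_ge j m with hjm | hjm
  · simp [hlow j hjm]
  · gcongr ‖a j‖ * ?_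
    exact pow_le_pow_of_le_one (norm_nonneg z) hz
      (lt_of_le_of_ne hjm (Finset.ne_of_mem_erase hj).symm)

theorem exists_normalForm_bound {G : ℂ × ℂ → ℂ × ℂ} {a b : ℕ → ℂ} {l : ℂ} {r t : ℕ}
    (ht : r + 1 < t) (ha : ∀ j < r + 1, a j = 0) (hb : ∀ j < r, b j = 0)
    (hG : (fun p : ℂ × ℂ => G p -
          (p.1 + ∑ j ∈ Finset.range t, a j * p.1 ^ j,
           l * p.2 + (∑ j ∈ Finset.range t, b j * p.1 ^ j) * p.2))
        =O[nhds 0] fun p : ℂ × ℂ => ‖p‖ ^ t) :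
    ∃ C : ℝ, 0 ≤ C ∧ ∀ᶠ p in nhds (0 : ℂ × ℂ),
      ‖(G p).1 - (p.1 + a (r + 1) * p.1 ^ (r + 1))‖ ≤ C * (‖p.1‖ ^ (r + 2) + ‖p‖ ^ t) ∧
      ‖(G p).2 - (l * p.2 + b r * p.1 ^ r * p.2)‖ ≤
        C * (‖p.1‖ ^ (r + 1) * ‖p.2‖ + ‖p‖ ^ t) := by
  obtain ⟨K, hK, hbound⟩ := hG.exists_pos
  set Sa := ∑ j ∈ Finset.range t, ‖a j‖
  set Sb := ∑ j ∈ Finset.range t, ‖b j‖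
  have hSa : 0 ≤ Sa := Finset.sum_nonneg fun _ _ => norm_nonneg _
  have hSb : 0 ≤ Sb := Finset.sum_nonneg fun _ _ => norm_nonneg _
  have hball : ∀ᶠ p in nhds (0 : ℂ × ℂ), ‖p.1‖ < 1 :=
    ((by fun_prop : Continuous fun p : ℂ × ℂ => ‖p.1‖).tendsto 0).eventually_lt_const (by simp)
  refine ⟨K + Sa + Sb, by positivity, ?_⟩
  filter_upwards [hbound.bound, hball] with p hp hz
  rw [Real.norm_of_nonneg (by positivity)] at hp
  have hA := norm_sum_range_sub_le a ht ha hz.le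
  have hB := norm_sum_range_sub_le b (by omega : r < t) hb hz.le
  constructor
  · have h1 := (norm_fst_le _).trans hp
    simp only [Prod.fst_sub] at h1
    have h2 := norm_add_le _ _ |>.trans (add_le_add h1 hA)
    have h3 : 0 ≤ ‖p.1‖ ^ (r + 2) := by positivity
    have h4 : 0 ≤ ‖p‖ ^ t := by positivity
    calc _ = _ := by congr 1; ring
      _ ≤ _ := h2
      _ ≤ _ := by nlinarith [mul_nonneg hK.le h3, mul_nonneg hSb h3,
          mul_nonneg hSb h4, mul_nonneg hSa h4]
  · have h1 := (norm_snd_le _).trans hp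
    simp only [Prod.snd_sub] at h1
    have hB' := mul_le_mul_of_nonneg_right hB (norm_nonneg p.2)
    rw [← norm_mul] at hB'
    have h2 := norm_add_le _ _ |>.trans (add_le_add h1 hB')
    have h3 : 0 ≤ ‖p.1‖ ^ (r + 1) * ‖p.2‖ := by positivity
    have h4 : 0 ≤ ‖p‖ ^ t := by positivity
    calc _ = _ := by congr 1; ring
      _ ≤ _ := h2
      _ ≤ _ := by nlinarith [mul_nonneg hK.le h3, mul_nonneg hSb h4,
          mul_nonneg hSa h3, mul_nonneg hSa h4]

theorem hasStrictFDerivAt_id_of_sub_isBigO {E : Type*} [NormedAddCommGroup E] [NormedSpace ℂ E]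
    {Ψ : E → E} (hΨ : AnalyticAt ℂ Ψ 0) (hΨ0 : Ψ 0 = 0)
    (h : (fun p => Ψ p - p) =O[nhds 0] fun p => ‖p‖ ^ 2) :
    HasStrictFDerivAt Ψ (ContinuousLinearEquiv.refl ℂ E : E →L[ℂ] E) 0 := by
  have h1 : HasFDerivAt Ψ (ContinuousLinearEquiv.refl ℂ E : E →L[ℂ] E) 0 := by
    refine HasFDerivAt.of_isLittleO ?_
    simpa [hΨ0] using h.trans_isLittleO (Asymptotics.isLittleO_norm_pow_id one_lt_two)
  rw [← h1.fderiv]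
  exact hΨ.hasStrictFDerivAt

theorem exists_injective_pow_eq {r : ℕ} (hr : r ≠ 0) {D : ℂ} (hD : D ≠ 0) :
    ∃ ζ : Fin r → ℂ, Function.Injective ζ ∧ ∀ i, ζ i ^ r = D := by
  obtain ⟨ζ₀, h₀⟩ := IsAlgClosed.exists_pow_nat_eq D (Nat.pos_of_ne_zero hr)
  have hζ₀ : ζ₀ ≠ 0 := fun h => hD (by rw [← h₀, h, zero_pow hr])
  have hω := Complex.isPrimitiveRoot_exp r hr
  refine ⟨fun i => ζ₀ * Complex.exp (2 * Real.pi * Complex.I / r) ^ (i : ℕ), fun i j hij => ?_,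
    fun i => ?_⟩
  · exact Fin.ext (hω.pow_inj i.2 j.2 (mul_left_cancel₀ hζ₀ hij))
  · rw [mul_pow, ← pow_mul, mul_comm (i : ℕ), pow_mul, hω.pow_eq_one, one_pow, mul_one, h₀]

/-- **Quasi-parabolic dynamically separating parabolically attracting case
(Corollary 6.3).**
Let `F` be a dynamically separating quasi-parabolic germ of holomorphic diffeomorphism of
`ℂ²` at `0`, formally conjugated (order by order) to
`F̂(z,w) = (z + Σ_{j≥ν} a_j z^j, e^{2πiθ} w + Σ_{j≥μ} b_j z^j w)` with `θ ∈ ℝ∖ℚ`,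
`a_ν ≠ 0`, `ν < ∞` and `ν ≤ μ + 1` (i.e. `b_j = 0` for `j < ν - 1`).
If `Re(b_{ν-1}/(e^{2πiθ} a_ν)) > 0`, then there exist `ν(F) - 1` pairwise disjoint connected
basins of attraction for `F` at `0`. -/
theorem quasi_parabolic_attracting_basins
    (θ : ℝ) (hθ : Irrational θ)
    (F : ℂ × ℂ → ℂ × ℂ)
    (hF : AnalyticAt ℂ F 0) (hF0 : F 0 = 0)
    (hqp : (fun p : ℂ × ℂ =>
        F p - (p.1, Complex.exp (2 * Real.pi * Complex.I * θ) * p.2))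
      =O[nhds 0] fun p : ℂ × ℂ => ‖p‖ ^ 2)
    -- the coefficients of the Poincaré–Dulac formal normal form of `F`
    (a b : ℕ → ℂ) (ha0 : a 0 = 0) (ha1 : a 1 = 0) (hb0 : b 0 = 0)
    (hconj : ∀ t : ℕ, ∃ Ψ G : ℂ × ℂ → ℂ × ℂ,
      AnalyticAt ℂ Ψ 0 ∧ Ψ 0 = 0 ∧
      ((fun p : ℂ × ℂ => Ψ p - p) =O[nhds 0] fun p : ℂ × ℂ => ‖p‖ ^ 2) ∧
      AnalyticAt ℂ G 0 ∧ (∀ᶠ p in nhds (0 : ℂ × ℂ), Ψ (F p) = G (Ψ p)) ∧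
      ((fun p : ℂ × ℂ => G p -
          (p.1 + ∑ j ∈ Finset.range t, a j * p.1 ^ j,
           Complex.exp (2 * Real.pi * Complex.I * θ) * p.2
             + (∑ j ∈ Finset.range t, b j * p.1 ^ j) * p.2))
        =O[nhds 0] fun p : ℂ × ℂ => ‖p‖ ^ t))
    -- `ν := ν(F) < ∞`, with `a_ν ≠ 0` and `a_j = 0` for `j < ν`
    (ν : ℕ) (hν : 2 ≤ ν) (haν : a ν ≠ 0) (halow : ∀ j, j < ν → a j = 0)
    -- `F` is dynamically separating: `ν ≤ μ + 1`, i.e. `b_j = 0` for `j < ν - 1`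
    (hsep : ∀ j, j < ν - 1 → b j = 0)
    -- `F` is parabolically attracting
    (hattr : 0 < (b (ν - 1) / (Complex.exp (2 * Real.pi * Complex.I * θ) * a ν)).re) :
    ∃ B : Fin (ν - 1) → Set (ℂ × ℂ),
      (∀ i, IsBasinAt2 F (B i)) ∧ (∀ i, IsConnected (B i)) ∧
        Pairwise (Function.onFun Disjoint B) := by
  obtain ⟨r, rfl⟩ : ∃ r, ν = r + 1 := ⟨ν - 1, by omega⟩
  simp only [Nat.add_sub_cancel] at hsep hattr ⊢
  have hr : r ≠ 0 := by omega
  have hl : ‖Complex.exp (2 * Real.pi * Complex.I * θ)‖ = 1 := by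
    rw [show 2 * Real.pi * Complex.I * θ = ((2 * Real.pi * θ : ℝ) : ℂ) * Complex.I by
      push_cast; ring]
    exact Complex.norm_exp_ofReal_mul_I _
  obtain ⟨β, κ, hβ, hκ, hκ1, hpetals⟩ := exists_invariant_fibredPetals hr haν hl hattr
  set D : ℂ := -(1 / (r * a (r + 1))) with hDdef
  have hD : D ≠ 0 := neg_ne_zero.2 (one_div_ne_zero (mul_ne_zero (by exact_mod_cast hr) haν))
  obtain ⟨t₀, ht₀⟩ := exists_nat_ge ((r + 2) / β)
  obtain ⟨Ψ, G, hΨ, hΨ0, hΨid, -, hΨG, hGt⟩ := hconj (t₀ + r + 2)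
  obtain ⟨C, hC, hGC⟩ := exists_normalForm_bound (by omega) halow hsep hGt
  have hβt : r + 2 ≤ β * ((t₀ + r + 2 : ℕ) : ℝ) := by
    rw [div_le_iff₀ hβ] at ht₀
    push_cast
    nlinarith [mul_nonneg hβ.le (Nat.cast_nonneg (α := ℝ) r)]
  have hstrict := hasStrictFDerivAt_id_of_sub_isBigO hΨ hΨ0 hΨid
  obtain ⟨e, he, he0⟩ : ∃ e : OpenPartialHomeomorph (ℂ × ℂ) (ℂ × ℂ),
      (e : ℂ × ℂ → ℂ × ℂ) = Ψ ∧ 0 ∈ e.source :=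
    ⟨hstrict.toOpenPartialHomeomorph Ψ, rfl, hstrict.mem_toOpenPartialHomeomorph_source⟩
  subst he
  have hsymm0 : e.symm 0 = 0 := by rw [← hΨ0, e.left_inv he0]; exact hΨ0.symm
  have htarget : (0 : ℂ × ℂ) ∈ e.target := by
    have := e.map_source he0
    rwa [hΨ0] at this
  have hsymmt : Tendsto e.symm (nhds 0) (nhds 0) := by
    have := e.tendsto_symm he0
    rwa [hΨ0] at this
  have hFt : Tendsto F (nhds 0) (nhds 0) := by
    have := hF.continuousAt.tendsto
    rwa [hF0] at this
  have hsource : e.source ∈ nhds (0 : ℂ × ℂ) := e.open_source.mem_nhds he0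
  obtain ⟨R, hR, hinv⟩ := hpetals _ G C hβt hC hGC
    (e.target ∩ e.symm ⁻¹' {p | F p ∈ e.source ∧ e (F p) = G (e p)})
    (inter_mem (e.open_target.mem_nhds htarget) (hsymmt (inter_mem (hFt hsource) hΨG)))
  obtain ⟨ζ, hζinj, hζ⟩ := exists_injective_pow_eq hr hD
  have hsub : ∀ i, fibredPetal r κ R β (ζ i) ⊆ e.target := fun i x hx =>
    ((hinv _ (hζ i)).1 hx).1
  have hζ0 : ∀ i, ζ i ≠ 0 := fun i h => hD (by rw [← hζ i, h, zero_pow hr])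
  have hconn : ∀ i, IsConnected (e.symm '' fibredPetal r κ R β (ζ i)) := fun i =>
    (isConnected_fibredPetal hr hκ hR hβ (hζ0 i)).image _ (e.symm.continuousOn.mono (hsub i))
  refine ⟨fun i => e.symm '' fibredPetal r κ R β (ζ i), fun i => ?_, hconn, fun i j hij => ?_⟩
  · refine isBasinAt2_of_height (fun p => fatouHeight r D (e p)) (hconn i).nonempty
      (e.isOpen_image_symm_of_subset_target (isOpen_fibredPetal r κ R hβ _) (hsub i)) ?_ ?_ ?_ ?_
    · rintro ⟨x, hx, hx0⟩
      have := e.right_inv (hsub i hx)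
      rw [hx0, hΨ0] at this
      exact fibredPetal_fst_ne_zero hx (by rw [← this]; rfl)
    · rintro _ ⟨x, hx, rfl⟩
      obtain ⟨hxt, hFs, hconjx⟩ := (hinv _ (hζ i)).1 hx
      obtain ⟨hGx, hheight⟩ := (hinv _ (hζ i)).2 x hx
      rw [e.right_inv hxt] at hconjx
      refine ⟨⟨G x, hGx, ?_⟩, ?_⟩
      · rw [← hconjx, e.left_inv hFs]
      · rw [hconjx, e.right_inv hxt]; exact hheight
    · intro ρ
      have het : Tendsto e (nhds 0) (nhds 0) := by
        have := (e.continuousAt he0).tendsto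
        rwa [hΨ0] at this
      filter_upwards [het (eventually_lt_fatouHeight (β := β) hr (hζ i) hD hκ hκ1 hR ρ)]
      rintro p hp ⟨x, hx, rfl⟩
      refine hp ?_
      rwa [e.right_inv (hsub i hx)]
    · intro N hN
      obtain ⟨ρ, -, hρ⟩ := exists_fatouHeight_small hr hD hβ (hsymmt hN)
      refine ⟨ρ, ?_⟩
      rintro _ ⟨x, hx, rfl⟩ hx'
      rw [e.right_inv (hsub i hx)] at hx'
      exact hρ x hx' hx.2
  · have hdisj := disjoint_fibredPetal (κ := κ) (R := R) (β := β) hr ((hζ i).trans (hζ j).symm)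
      (hζinj.ne hij)
    exact Set.disjoint_image_image fun x hx y hy hxy => Set.disjoint_left.1 hdisj hx
      ((e.symm.injOn (hsub i hx) (hsub j hy) hxy) ▸ hy)
end
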